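/- Let ℓ ≥ 5 be an integer, let n ≥ ℓ, and let π = (d_1, …, d_n) be a non-increasing graphic sequence of nonnegative integers such that d_{ℓ+1−i} ≥ i+1 for every integer i with 1 ≤ i < ℓ/2 (equivalently, for i = 1, …, ⌈ℓ/2⌉ − 1). Then π is potentially ₃C_ℓ-graphic, i.e., π has a realization containing cycles of every length r with 3 ≤ r ≤ ℓ. -/

import Mathlib

/-- `G` contains a cycle of length `r`. -/
def hasCycleOfLength {V : Type*} (G : SimpleGraph V) (r : ℕ) : Prop :=
  ∃ (v : V) (c : G.Walk v v), c.IsCycle ∧ c.length = r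

/-- `G` is a realization of the sequence `d`, i.e. `d` is its degree sequence. -/
def IsDegreeSeq {n : ℕ} (G : SimpleGraph (Fin n)) (d : Fin n → ℕ) : Prop :=
  ∀ i, (G.neighborSet i).ncard = d i

/-- The sequence `d` is graphic: it is the degree sequence of a simple graph. -/
def Graphic {n : ℕ} (d : Fin n → ℕ) : Prop :=
  ∃ G : SimpleGraph (Fin n), IsDegreeSeq G d

/-- `d` is potentially ₃Cℓ-graphic: some realization contains cycles of every
length `r` with `3 ≤ r ≤ ℓ`. -/
def Pot3C {n : ℕ} (ℓ : ℕ) (d : Fin n → ℕ) : Prop :=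
  ∃ G : SimpleGraph (Fin n), IsDegreeSeq G d ∧ ∀ r, 3 ≤ r → r ≤ ℓ → hasCycleOfLength G r

/-- `d` is potentially Cℓ-graphic: some realization contains a cycle of length `ℓ`. -/
def PotC {n : ℕ} (ℓ : ℕ) (d : Fin n → ℕ) : Prop :=
  ∃ G : SimpleGraph (Fin n), IsDegreeSeq G d ∧ hasCycleOfLength G ℓ

/-- `d` has a realization `G` containing cycles `C₃, …, C_ℓ` on those vertices with
degrees `d 0, …, d (ℓ-1)`: the induced subgraph on some vertex set `S`, whose multiset
of degrees is that of the first `ℓ` terms of `d`, contains cycles of all lengths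
from `3` to `ℓ`. -/
def RealizationWithCyclesOn {n : ℕ} (ℓ : ℕ) (d : Fin n → ℕ) : Prop :=
  ∃ (G : SimpleGraph (Fin n)) (S : Finset (Fin n)),
    IsDegreeSeq G d ∧ S.card = ℓ ∧
    S.val.map d = (Finset.univ.filter (fun i : Fin n => (i : ℕ) < ℓ)).val.map d ∧
    ∀ r, 3 ≤ r → r ≤ ℓ → hasCycleOfLength (G.induce (S : Set (Fin n))) r

set_option linter.all false
namespace PT
open Finset
open scoped Classical

section A
variable {V : Type} [Fintype V]

noncomputable def nb (G : SimpleGraph V) (v : V) : Finset V := univ.filter (fun u => G.Adj v u)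

theorem mem_nb {G : SimpleGraph V} {v u : V} : u ∈ nb G v ↔ G.Adj v u := by simp [nb]

def RL (G : SimpleGraph V) (d : V → ℕ) : Prop := ∀ v, (nb G v).card = d v

def gr (d : V → ℕ) : Prop := ∃ G : SimpleGraph V, RL G d

def addE (G : SimpleGraph V) (a b : V) : SimpleGraph V where
  Adj u v := G.Adj u v ∨ (a ≠ b ∧ ((u = a ∧ v = b) ∨ (u = b ∧ v = a)))
  symm := ⟨by
    rintro u v (h | ⟨h, h2⟩)
    · exact Or.inl h.symm
    · exact Or.inr ⟨h, by tauto⟩⟩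
  loopless := ⟨by
    rintro u (h | ⟨h, h2⟩)
    · exact G.loopless.irrefl u h
    · rcases h2 with ⟨h1, h2⟩ | ⟨h1, h2⟩ <;> exact h (by simp_all)⟩

def delE (G : SimpleGraph V) (a b : V) : SimpleGraph V where
  Adj u v := G.Adj u v ∧ ¬ ((u = a ∧ v = b) ∨ (u = b ∧ v = a))
  symm := ⟨by
    rintro u v ⟨h, h2⟩
    exact ⟨h.symm, by tauto⟩⟩
  loopless := ⟨by
    rintro u ⟨h, h2⟩
    exact G.loopless.irrefl u h⟩

def star (G : SimpleGraph V) (w : V) (W : Finset V) : SimpleGraph V where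
  Adj u v := G.Adj u v ∨ (u ≠ v ∧ ((u = w ∧ v ∈ W) ∨ (v = w ∧ u ∈ W)))
  symm := ⟨by
    rintro u v (h | ⟨h, h2⟩)
    · exact Or.inl h.symm
    · exact Or.inr ⟨h.symm, by tauto⟩⟩
  loopless := ⟨by
    rintro u (h | ⟨h, h2⟩)
    · exact G.loopless.irrefl u h
    · exact h rfl⟩

def delV (G : SimpleGraph V) (w : V) : SimpleGraph V where
  Adj u v := G.Adj u v ∧ u ≠ w ∧ v ≠ w
  symm := ⟨by
    rintro u v ⟨h, h2⟩
    exact ⟨h.symm, by tauto⟩⟩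
  loopless := ⟨by
    rintro u ⟨h, h2⟩
    exact G.loopless.irrefl u h⟩

theorem RL_addE {G : SimpleGraph V} {d : V → ℕ} (h : RL G d) {a b : V} (hab : a ≠ b)
    (hn : ¬ G.Adj a b) :
    RL (addE G a b) (fun v => d v + (if v = a then 1 else 0) + (if v = b then 1 else 0)) := by
  intro v
  have h0 := h v
  by_cases ha : v = a
  · subst ha
    have : nb (addE G v b) v = insert b (nb G v) := by
      ext u; simp only [mem_nb, mem_insert, addE]
      constructor
      · rintro (h | ⟨_, ⟨_, h⟩ | ⟨h, _⟩⟩)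
        · exact Or.inr h
        · exact Or.inl h
        · exact absurd h hab
      · rintro (h | h)
        · exact Or.inr ⟨hab, Or.inl ⟨trivial, h⟩⟩
        · exact Or.inl h
    rw [this, card_insert_of_notMem (by simpa [mem_nb] using hn), h0]
    simp [hab]
  · by_cases hb : v = b
    · subst hb
      have : nb (addE G a v) v = insert a (nb G v) := by
        ext u; simp only [mem_nb, mem_insert, addE]
        constructor
        · rintro (h | ⟨_, ⟨h, _⟩ | ⟨_, h⟩⟩)
          · exact Or.inr h
          · exact absurd h ha
          · exact Or.inl h
        · rintro (h | h)
          · exact Or.inr ⟨hab, Or.inr ⟨trivial, h⟩⟩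
          · exact Or.inl h
      rw [this, card_insert_of_notMem (by rw [mem_nb]; exact fun h => hn h.symm), h0]
      simp [ha]
    · have : nb (addE G a b) v = nb G v := by
        ext u; simp [mem_nb, addE, ha, hb]
      rw [this, h0]; simp [ha, hb]

theorem RL_delE {G : SimpleGraph V} {d : V → ℕ} (h : RL G d) {a b : V}
    (hn : G.Adj a b) :
    RL (delE G a b) (fun v => d v - (if v = a then 1 else 0) - (if v = b then 1 else 0)) := by
  intro v
  have h0 := h v
  have hab := hn.ne
  by_cases ha : v = a
  · subst ha
    have : nb (delE G v b) v = (nb G v).erase b := by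
      ext u; simp only [mem_nb, mem_erase, delE]
      constructor
      · rintro ⟨h1, h2⟩
        exact ⟨fun h => h2 (Or.inl ⟨trivial, h⟩), h1⟩
      · rintro ⟨h1, h2⟩
        refine ⟨h2, ?_⟩
        rintro (⟨_, h⟩ | ⟨h, _⟩)
        · exact h1 h
        · exact hab h
    rw [this, card_erase_of_mem (by simpa [mem_nb] using hn), h0]
    simp [hab]
  · by_cases hb : v = b
    · subst hb
      have : nb (delE G a v) v = (nb G v).erase a := by
        ext u; simp only [mem_nb, mem_erase, delE]
        constructor
        · rintro ⟨h1, h2⟩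
          exact ⟨fun h => h2 (Or.inr ⟨trivial, h⟩), h1⟩
        · rintro ⟨h1, h2⟩
          refine ⟨h2, ?_⟩
          rintro (⟨h, _⟩ | ⟨_, h⟩)
          · exact ha h
          · exact h1 h
      rw [this, card_erase_of_mem (by rw [mem_nb]; exact hn.symm), h0]
      simp [ha]
    · have : nb (delE G a b) v = nb G v := by
        ext u; simp [mem_nb, delE, ha, hb]
      rw [this, h0]; simp [ha, hb]

theorem RL_star {G : SimpleGraph V} {d : V → ℕ} (h : RL G d) {w : V} {W : Finset V}
    (hw : w ∉ W) (hn : ∀ u ∈ W, ¬ G.Adj w u) :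
    RL (star G w W) (fun v => d v + (if v ∈ W then 1 else 0) + (if v = w then W.card else 0)) := by
  intro v
  have h0 := h v
  by_cases ha : v = w
  · subst ha
    have : nb (star G v W) v = nb G v ∪ W := by
      ext u; simp only [mem_nb, mem_union, star]
      constructor
      · rintro (h | ⟨_, ⟨_, h⟩ | ⟨_, h⟩⟩)
        · exact Or.inl h
        · exact Or.inr h
        · exact absurd h hw
      · rintro (h | h)
        · exact Or.inl h
        · exact Or.inr ⟨fun e => hw (e ▸ h), Or.inl ⟨trivial, h⟩⟩
    rw [this, card_union_of_disjoint, h0]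
    · simp [hw]
    · rw [disjoint_left]; intro u hu hu2
      exact hn u hu2 (mem_nb.1 hu)
  · by_cases hb : v ∈ W
    · have : nb (star G w W) v = insert w (nb G v) := by
        ext u; simp only [mem_nb, mem_insert, star]
        constructor
        · rintro (h | ⟨_, ⟨h, _⟩ | ⟨h, _⟩⟩)
          · exact Or.inr h
          · exact absurd h ha
          · exact Or.inl h
        · rintro (h | h)
          · exact Or.inr ⟨fun e => ha (e.trans h), Or.inr ⟨h, hb⟩⟩
          · exact Or.inl h
      rw [this, card_insert_of_notMem (by rw [mem_nb]; exact fun h => hn v hb h.symm), h0]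
      simp [ha, hb]
    · have : nb (star G w W) v = nb G v := by
        ext u; simp [mem_nb, star, ha, hb]
      rw [this, h0]; simp [ha, hb]

theorem RL_delV {G : SimpleGraph V} {d : V → ℕ} (h : RL G d) (w : V) :
    RL (delV G w) (fun v => if v = w then 0 else d v - (if v ∈ nb G w then 1 else 0)) := by
  intro v
  have h0 := h v
  by_cases ha : v = w
  · subst ha
    have : nb (delV G v) v = ∅ := by
      ext u; simp [mem_nb, delV]
    simp [this]
  · have : nb (delV G w) v = (nb G v).erase w := by
      ext u; simp only [mem_nb, mem_erase, delV]; tauto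
    rw [this]
    by_cases hb : v ∈ nb G w
    · rw [card_erase_of_mem (by rw [mem_nb] at *; exact hb.symm)]; simp [ha, hb, h0]
    · rw [erase_eq_of_notMem (by rw [mem_nb] at *; exact fun h => hb h.symm)]; simp [ha, hb, h0]

/-- two-switch -/
theorem switch {G : SimpleGraph V} {d : V → ℕ} (h : RL G d) {a b c e : V}
    (hab : G.Adj a b) (hce : G.Adj c e) (hac : ¬ G.Adj a c) (hbe : ¬ G.Adj b e)
    (nac : a ≠ c) (nbe : b ≠ e) :
    RL (addE (addE (delE (delE G a b) c e) a c) b e) d := by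
  have nab := hab.ne
  have nce := hce.ne
  have nae : a ≠ e := by rintro rfl; exact hac hce.symm
  have nbc : b ≠ c := by rintro rfl; exact hac hab
  have h1 := RL_delE h hab
  have h2 := RL_delE (G := delE G a b) h1 (a := c) (b := e) ⟨hce, by rintro (⟨h, _⟩ | ⟨h, _⟩); exact nac h.symm; exact nbc h.symm⟩
  have h3 := RL_addE h2 nac (fun h => hac h.1.1)
  have h4 := RL_addE h3 nbe (by
    rintro (h | ⟨_, ⟨h, _⟩ | ⟨h, _⟩⟩)
    · exact hbe h.1.1
    · exact nab h.symm
    · exact nbc h)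
  intro v
  rw [h4 v]
  have p1 : ∀ {x y : V}, G.Adj x y → 1 ≤ d x := by
    intro x y hxy; rw [← h x]; exact card_pos.2 ⟨y, mem_nb.2 hxy⟩
  have := p1 hab; have := p1 hab.symm; have := p1 hce; have := p1 hce.symm
  by_cases v1 : v = a
  · subst v1; simp [nab, nac, nae]; omega
  by_cases v2 : v = b
  · subst v2; simp [nab.symm, nbc, nbe]; omega
  by_cases v3 : v = c
  · subst v3; simp [nac.symm, nbc.symm, nce]; omega
  by_cases v4 : v = e
  · subst v4; simp [nae.symm, nbe.symm, nce.symm]; omega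
  simp [v1, v2, v3, v4]

def IsCy (G : SimpleGraph V) (k : ℕ) (p : ℕ → V) : Prop :=
  (∀ i < k, ∀ j < k, p i = p j → i = j) ∧ (∀ i, i + 1 < k → G.Adj (p i) (p (i+1))) ∧
  G.Adj (p (k-1)) (p 0)

def Cyc (G : SimpleGraph V) (S : Finset V) (k : ℕ) : Prop :=
  ∃ p, IsCy G k p ∧ ∀ i < k, p i ∈ S

theorem Cyc.mono {G H : SimpleGraph V} {S T : Finset V} {k : ℕ}
    (hGH : ∀ a ∈ S, ∀ b ∈ S, G.Adj a b → H.Adj a b) (hST : S ⊆ T) (hk : 0 < k) (h : Cyc G S k) : Cyc H T k := by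
  obtain ⟨p, ⟨h1, h2, h3⟩, h4⟩ := h
  exact ⟨p, ⟨h1, fun i hi => hGH _ (h4 _ (by omega)) _ (h4 _ hi) (h2 i hi),
    hGH _ (h4 _ (by omega)) _ (h4 _ hk) h3⟩, fun i hi => hST (h4 i hi)⟩

theorem rot {G : SimpleGraph V} {k : ℕ} {p : ℕ → V} (h : IsCy G k p) (hk : 2 ≤ k) {j : ℕ} (hj : j < k) :
    ∃ p', IsCy G k p' ∧ p' 0 = p ((j+1) % k) ∧ p' (k-1) = p j ∧ (∀ i < k, ∃ i' < k, p' i = p i') ∧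
      (∀ i < k, ∃ i' < k, p i = p' i') := by
  obtain ⟨h1, h2, h3⟩ := h
  have hstep : ∀ a, G.Adj (p (a % k)) (p ((a+1) % k)) := by
    intro a
    have hlt := Nat.mod_lt a (by omega : k > 0)
    by_cases hc : a % k + 1 < k
    · have : (a+1) % k = a % k + 1 := by
        rw [Nat.add_mod, Nat.mod_eq_of_lt (by omega : 1 < k), Nat.mod_eq_of_lt hc]
      rw [this]; exact h2 _ hc
    · have e : a % k = k - 1 := by omega
      have : (a+1) % k = 0 := by
        rw [Nat.add_mod, Nat.mod_eq_of_lt (by omega : 1 < k), e]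
        rw [Nat.sub_add_cancel (by omega)]; simp
      rw [this, e]; exact h3
  refine ⟨fun i => p ((j + 1 + i) % k), ⟨?_, ?_, ?_⟩, by simp, ?_, ?_, ?_⟩
  · intro a ha b hb hab
    have := h1 _ (Nat.mod_lt _ (by omega)) _ (Nat.mod_lt _ (by omega)) hab
    have h5 : (j+1+a) ≡ (j+1+b) [MOD k] := this
    have h6 := Nat.ModEq.add_left_cancel' (j+1) h5
    exact Nat.ModEq.eq_of_lt_of_lt h6 ha hb
  · intro i _
    exact hstep (j+1+i)
  · have := hstep (j + 1 + (k-1))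
    have e : j + 1 + (k - 1) + 1 = (j + 1) + k := by omega
    rw [e, Nat.add_mod_right] at this
    simpa using this
  · show p ((j+1+(k-1)) % k) = p j
    have e : j + 1 + (k - 1) = j + k := by omega
    rw [e, Nat.add_mod_right, Nat.mod_eq_of_lt hj]
  · intro i _
    exact ⟨_, Nat.mod_lt _ (by omega), rfl⟩
  · intro i hi
    refine ⟨(i + k - 1 - j) % k, Nat.mod_lt _ (by omega), ?_⟩
    show p i = p _
    congr 1
    rw [Nat.add_mod_mod]
    have : j + 1 + (i + k - 1 - j) = i + k := by omega
    rw [this, Nat.add_mod_right, Nat.mod_eq_of_lt hi]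

theorem Cyc.pos {G : SimpleGraph V} {S : Finset V} {k : ℕ} (hk : 2 ≤ k) {p : ℕ → V} (h : IsCy G k p) {i : ℕ} (hi : i < k) :
    ∃ u, G.Adj (p i) u := by
  by_cases hc : i + 1 < k
  · exact ⟨_, h.2.1 i hc⟩
  · have : i = k - 1 := by omega
    subst this; exact ⟨_, h.2.2⟩

end A
end PT

set_option linter.all false
namespace PT
open Finset
open scoped Classical

section B
variable {V : Type} [Fintype V]

theorem RL.congr {G : SimpleGraph V} {d d' : V → ℕ} (h : RL G d) (e : ∀ v, d v = d' v) : RL G d' :=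
  fun v => (h v).trans (e v)

theorem RL.even {G : SimpleGraph V} {d : V → ℕ} (h : RL G d) : Even (∑ v, d v) := by
  have h1 := G.sum_degrees_eq_twice_card_edges
  have : ∑ v, d v = ∑ v, G.degree v := by
    apply sum_congr rfl
    intro v _
    rw [← h v, ← SimpleGraph.card_neighborFinset_eq_degree]
    congr 1
    ext u; simp [mem_nb]
  rw [this, h1]; exact even_two_mul _

theorem exists_priv {G : SimpleGraph V} {d : V → ℕ} (h : RL G d) {e z : V} (hne : e ≠ z)
    (hlt : d z < d e) : ∃ f, G.Adj e f ∧ ¬ G.Adj z f ∧ f ≠ z := by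
  by_contra hc
  push Not at hc
  by_cases ha : G.Adj e z
  · have : (nb G e).erase z ⊆ (nb G z).erase e := by
      intro f hf
      rw [mem_erase, mem_nb] at *
      refine ⟨fun hh => hf.2.ne hh.symm, ?_⟩
      by_contra h2
      exact hf.1 (hc f hf.2 h2)
    have := card_le_card this
    rw [card_erase_of_mem (mem_nb.2 ha), card_erase_of_mem (mem_nb.2 ha.symm), h, h] at this
    have : 1 ≤ d z := by rw [← h z]; exact card_pos.2 ⟨e, mem_nb.2 ha.symm⟩
    omega
  · have : (nb G e) ⊆ (nb G z) := by
      intro f hf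
      rw [mem_nb] at *
      by_contra h2
      have := hc f hf h2
      subst this
      exact ha hf
    have := card_le_card this
    rw [h, h] at this
    omega

/-- move edges -/
theorem raise2 {G : SimpleGraph V} {d : V → ℕ} (h : RL G d) {e f z z' : V}
    (hef : G.Adj e f) (h1 : ¬ G.Adj z e) (h2 : ¬ G.Adj z' f) (nze : z ≠ e) (nzf : z' ≠ f)
    (hd : ¬ (z = f ∧ z' = e)) :
    RL (addE (addE (delE G e f) z e) z' f)
      (fun v => d v + (if v = z then 1 else 0) + (if v = z' then 1 else 0)) := by
  have nef := hef.ne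
  have a1 := RL_delE h hef
  have a2 := RL_addE a1 nze (fun h => h1 h.1)
  have a3 := RL_addE a2 nzf (by
    rintro (h | ⟨_, ⟨h, h'⟩ | ⟨h, h'⟩⟩)
    · exact h2 h.1
    · exact nef h'.symm
    · exact hd ⟨h'.symm, h⟩)
  refine a3.congr ?_
  intro v
  have p1 : 1 ≤ d e := by rw [← h e]; exact card_pos.2 ⟨f, mem_nb.2 hef⟩
  have p2 : 1 ≤ d f := by rw [← h f]; exact card_pos.2 ⟨e, mem_nb.2 hef.symm⟩
  by_cases v1 : v = e
  · subst v1; simp [nef]; omega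
  by_cases v2 : v = f
  · subst v2; simp [nef.symm]; omega
  simp [v1, v2]

theorem exists_notin_nb {G : SimpleGraph V} {d : V → ℕ} (h : RL G d) {z : V} {T : Finset V}
    (hlt : d z < T.card) : ∃ e ∈ T, ¬ G.Adj z e := by
  by_contra hc
  push Not at hc
  have : T ⊆ nb G z := fun e he => mem_nb.2 (hc e he)
  have := card_le_card this
  rw [h] at this; omega

theorem FG (M N : ℕ) : ∀ (d : V → ℕ) (X T0 : Finset V), X.card + ∑ v, d v ≤ N →
    (∀ v, v ∉ X → d v = 0) → T0 ⊆ X → T0.card = M + 1 → (∀ v ∈ T0, M ≤ d v ∧ d v < X.card) →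
    (∀ v ∈ X, v ∉ T0 → (T0.filter (fun u => M < d u)).card ≤ d v ∧ d v ≤ M) →
    Even (∑ v, d v) → gr d := by
  induction N with
  | zero =>
    intro d X T0 hN h0 hTX hT h1 h2 hev
    have : X.card = 0 := by omega
    have := card_le_card hTX
    omega
  | succ N ih =>
    intro d X T0 hN h0 hTX hT h1 h2 hev
    set q := (T0.filter (fun u => M < d u)).card with hq
    by_cases c1 : ∃ z ∈ X, z ∉ T0 ∧ q + 2 ≤ d z
    · obtain ⟨z, hzX, hzT, hz⟩ := c1
      set d' : V → ℕ := fun v => d v - (if v = z then 2 else 0) with hd'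
      have hsum : ∑ v, d v = ∑ v, d' v + 2 := by
        have : ∑ v, d v = ∑ v, (d' v + if v = z then 2 else 0) := by
          apply sum_congr rfl
          intro v _
          simp only [hd']
          by_cases hv : v = z
          · subst hv; simp; omega
          · simp [hv]
        rw [this, sum_add_distrib]; simp
      have hdT : ∀ v ∈ T0, d' v = d v := by
        intro v hv
        have : v ≠ z := fun e => hzT (e ▸ hv)
        simp [hd', this]
      have hqe : (T0.filter (fun u => M < d' u)).card = q := by
        rw [hq]; congr 1; apply filter_congr; intro v hv; rw [hdT v hv]
      obtain ⟨G, hG⟩ := ih d' X T0 (by omega) (by intro v hv; simp [hd', h0 v hv]) hTX hT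
        (by intro v hv; rw [hdT v hv]; exact h1 v hv)
        (by
          intro v hv hv2
          rw [hqe]
          have := h2 v hv hv2
          by_cases e : v = z
          · subst e; simp [hd']; omega
          · simp [hd', e]; omega)
        (by rw [hsum] at hev; exact (Nat.even_add.1 hev).2 (by decide))
      have hz' := h2 z hzX hzT
      have hdz : d' z = d z - 2 := by simp [hd']
      obtain ⟨e, heT, hze⟩ := exists_notin_nb hG (z := z) (T := T0) (by omega)
      have hne : e ≠ z := fun e' => hzT (e' ▸ heT)
      obtain ⟨f, hf1, hf2, hf3⟩ := exists_priv hG hne (by rw [hdT e heT]; have := h1 e heT; omega)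
      refine ⟨_, (raise2 hG hf1 hze hf2 hne.symm hf3.symm (fun hh => hf3 hh.1.symm)).congr ?_⟩
      intro v
      by_cases e : v = z
      · subst e; simp [hd']; omega
      · simp [hd', e]
    by_cases c2 : ∃ z ∈ X, z ∉ T0 ∧ q + 1 ≤ d z ∧ ∃ z' ∈ X, z' ∉ T0 ∧ q + 1 ≤ d z' ∧ z ≠ z'
    · obtain ⟨z, hzX, hzT, hz, z', hzX', hzT', hz', hzz⟩ := c2
      set d' : V → ℕ := fun v => d v - (if v = z then 1 else 0) - (if v = z' then 1 else 0) with hd'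
      have hback : ∀ v, d' v + (if v = z then 1 else 0) + (if v = z' then 1 else 0) = d v := by
        intro v
        simp only [hd']
        by_cases hv : v = z
        · subst hv; simp [hzz]; omega
        · by_cases hv' : v = z'
          · subst hv'; simp [hv]; omega
          · simp [hv, hv']
      have hsum : ∑ v, d v = ∑ v, d' v + 2 := by
        rw [← sum_congr rfl (fun v _ => hback v), sum_add_distrib, sum_add_distrib]; simp
      have hdT : ∀ v ∈ T0, d' v = d v := by
        intro v hv
        have : v ≠ z := fun e => hzT (e ▸ hv)
        have : v ≠ z' := fun e => hzT' (e ▸ hv)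
        simp [hd', *]
      have hqe : (T0.filter (fun u => M < d' u)).card = q := by
        rw [hq]; congr 1; apply filter_congr; intro v hv; rw [hdT v hv]
      obtain ⟨G, hG⟩ := ih d' X T0 (by omega) (by intro v hv; simp [hd', h0 v hv]) hTX hT
        (by intro v hv; rw [hdT v hv]; exact h1 v hv)
        (by
          intro v hv hv2
          rw [hqe]
          have := h2 v hv hv2
          by_cases e : v = z
          · subst e; simp [hd', hzz]; omega
          · by_cases e' : v = z'
            · subst e'; simp [hd', e]; omega
            · simp [hd', e, e']; omega)
        (by rw [hsum] at hev; exact (Nat.even_add.1 hev).2 (by decide))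
      have hzM := h2 z hzX hzT
      have hzM' := h2 z' hzX' hzT'
      have hdz : d' z = d z - 1 := by simp [hd', hzz]
      have hdz' : d' z' = d z' - 1 := by simp [hd', hzz.symm]
      by_cases had : G.Adj z z'
      · obtain ⟨e, heT, hze⟩ := exists_notin_nb hG (z := z) (T := T0) (by omega)
        have hne : e ≠ z := fun e' => hzT (e' ▸ heT)
        have hne' : e ≠ z' := fun e' => hzT' (e' ▸ heT)
        obtain ⟨f, hf1, hf2, hf3⟩ := exists_priv hG hne' (by rw [hdT e heT]; have := h1 e heT; omega)
        exact ⟨_, (raise2 hG hf1 hze hf2 hne.symm hf3.symm (fun hh => hne' hh.2.symm)).congr hback⟩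
      · exact ⟨_, (RL_addE hG hzz had).congr hback⟩
    by_cases c3 : ∃ z ∈ X, z ∉ T0 ∧ d z = q
    · obtain ⟨z, hzX, hzT, hz⟩ := c3
      set Q := T0.filter (fun u => M < d u) with hQ
      have hzQ : z ∉ Q := fun h => hzT (mem_filter.1 h).1
      set d' : V → ℕ := fun v => if v = z then 0 else d v - (if v ∈ Q then 1 else 0) with hd'
      have hQ1 : ∀ v ∈ Q, M < d v := fun v hv => (mem_filter.1 hv).2
      have hback : ∀ v, d' v + (if v ∈ Q then 1 else 0) + (if v = z then Q.card else 0) = d v := by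
        intro v
        simp only [hd']
        by_cases hv : v = z
        · subst hv; simp [hzQ]; omega
        · by_cases hv' : v ∈ Q
          · have := hQ1 v hv'
            simp [hv, hv']; omega
          · simp [hv, hv']
      have hsum : ∑ v, d v = ∑ v, d' v + 2 * q := by
        rw [← sum_congr rfl (fun v _ => hback v), sum_add_distrib, sum_add_distrib]; simp; omega
      have hXc : (X.erase z).card = X.card - 1 := card_erase_of_mem hzX
      have hXM : M + 2 ≤ X.card := by
        have : insert z T0 ⊆ X := by
          intro v hv; rcases mem_insert.1 hv with rfl | hv
          · exact hzX
          · exact hTX hv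
        have := card_le_card this
        rw [card_insert_of_notMem hzT] at this
        omega
      have hqle : (T0.filter (fun u => M < d' u)).card ≤ q := by
        apply card_le_card
        intro v hv
        rw [mem_filter] at *
        refine ⟨hv.1, lt_of_lt_of_le hv.2 ?_⟩
        simp only [hd']; split_ifs <;> omega
      obtain ⟨G, hG⟩ := ih d' (X.erase z) T0 (by omega)
        (by
          intro v hv
          by_cases e : v = z
          · simp [hd', e]
          · have : v ∉ X := fun h => hv (mem_erase.2 ⟨e, h⟩)
            simp [hd', h0 v this])
        (by intro v hv; exact mem_erase.2 ⟨fun e => hzT (e ▸ hv), hTX hv⟩) hT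
        (by
          intro v hv
          have e : v ≠ z := fun e => hzT (e ▸ hv)
          have := h1 v hv
          by_cases hvQ : v ∈ Q
          · have := hQ1 v hvQ
            simp [hd', e, hvQ, hXc]; omega
          · have : ¬ M < d v := fun h => hvQ (mem_filter.2 ⟨hv, h⟩)
            simp [hd', e, hvQ, hXc]; omega)
        (by
          intro v hv hv2
          have hv := mem_erase.1 hv
          have := h2 v hv.2 hv2
          have hvQ : v ∉ Q := fun h => hv2 (mem_filter.1 h).1
          have hdv : d' v = d v := by simp [hd', hv.1, hvQ]
          rw [hdv]; omega)
        (by rw [hsum] at hev; exact (Nat.even_add.1 hev).2 (by simp))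
      have hiso : nb G z = ∅ := by
        rw [← card_eq_zero, hG z]; simp [hd']
      refine ⟨_, (RL_star hG hzQ ?_).congr hback⟩
      intro u _ hu
      have := mem_nb.2 hu
      rw [hiso] at this; simp at this
    by_cases c4 : X = T0
    · subst c4
      have hd : ∀ v ∈ X, d v = M := fun v hv => by have := h1 v hv; omega
      refine ⟨SimpleGraph.mk (fun u v => u ≠ v ∧ u ∈ X ∧ v ∈ X) ⟨fun u v h => ⟨h.1.symm, h.2.2, h.2.1⟩⟩ ⟨fun u h => h.1 rfl⟩, ?_⟩
      intro v
      by_cases hv : v ∈ X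
      · have : nb (SimpleGraph.mk (fun u v => u ≠ v ∧ u ∈ X ∧ v ∈ X) ⟨fun u v h => ⟨h.1.symm, h.2.2, h.2.1⟩⟩ ⟨fun u h => h.1 rfl⟩) v = X.erase v := by
          ext u; rw [mem_nb]; simp [hv]; tauto
        rw [this, card_erase_of_mem hv, hd v hv, hT]; simp
      · rw [h0 v hv, card_eq_zero]
        ext u; rw [mem_nb]; simp [hv]
    · exfalso
      obtain ⟨z, hzX, hzT⟩ : ∃ z ∈ X, z ∉ T0 := by
        by_contra hc; push Not at hc
        exact c4 (Subset.antisymm hc hTX)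
      have hz : d z = q + 1 := by
        have := h2 z hzX hzT
        by_contra hne
        by_cases h : d z = q
        · exact c3 ⟨z, hzX, hzT, h⟩
        · exact c1 ⟨z, hzX, hzT, by omega⟩
      have hX : X = insert z T0 := by
        apply Subset.antisymm
        · intro v hv
          by_contra hh
          rw [mem_insert, not_or] at hh
          have h3 := h2 v hv hh.2
          have : d v ≠ q := fun h => c3 ⟨v, hv, hh.2, h⟩
          exact c2 ⟨z, hzX, hzT, by omega, v, hv, hh.2, by omega, fun h => hh.1 h.symm⟩
        · intro v hv; rcases mem_insert.1 hv with rfl | hv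
          · exact hzX
          · exact hTX hv
      have hXc : X.card = M + 2 := by rw [hX, card_insert_of_notMem hzT, hT]
      have hs : ∑ v, d v = ∑ v ∈ X, d v := by
        symm; apply sum_subset (subset_univ _); intro v _ hv; exact h0 v hv
      have hs2 : ∑ v ∈ T0, d v = ∑ v ∈ T0, (M + if M < d v then 1 else 0) := by
        apply sum_congr rfl
        intro v hv
        have := h1 v hv
        split_ifs <;> omega
      rw [sum_add_distrib, sum_const, ← card_filter, hT, ← hq, smul_eq_mul] at hs2
      rw [hs, hX, sum_insert hzT, hs2, hz] at hev
      have h5 := Nat.even_mul_succ_self M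
      rw [show q + 1 + ((M+1) * M + q) = M * (M+1) + (2 * q + 1) by ring] at hev
      have := (Nat.even_add.1 hev).1 h5
      rw [Nat.even_add_one] at this
      exact this (even_two_mul q)

end B
end PT

set_option linter.all false
namespace PT
open Finset
open scoped Classical

section C
variable {V : Type} [Fintype V]

theorem IsCy.rev {G : SimpleGraph V} {k : ℕ} {p : ℕ → V} (h : IsCy G k p) (hk : 1 ≤ k) :
    IsCy G k (fun i => p (k - 1 - i)) := by
  obtain ⟨h1, h2, h3⟩ := h
  refine ⟨?_, ?_, ?_⟩
  · intro i hi j hj hij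
    have := h1 _ (by omega) _ (by omega) hij
    omega
  · intro i hi
    have := h2 (k - 1 - (i+1)) (by omega)
    rw [show k - 1 - (i+1) + 1 = k - 1 - i by omega] at this
    exact this.symm
  · simp only [Nat.sub_self, Nat.sub_zero]; exact h3.symm

noncomputable def dS (G : SimpleGraph V) (S : Finset V) (v : V) : ℕ := ((nb G v).filter (· ∈ S)).card

theorem posa {G : SimpleGraph V} {S : Finset V} {l : ℕ} (hl : 3 ≤ l) (hS : S.card = l)
    (H : ∀ i, 1 ≤ i → 2 * i < l → (S.filter (fun v => dS G S v ≤ i)).card < i) : Cyc G S l := by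
  by_contra hno
  obtain ⟨F, hGF, hmax⟩ := Set.Finite.exists_le_maximal
    (Set.toFinite {F : SimpleGraph V | ¬ Cyc F S l}) (a := G) hno
  have hF : ¬ Cyc F S l := hmax.prop
  have hdeg : ∀ v, dS G S v ≤ dS F S v := by
    intro v; apply card_le_card; intro u hu
    rw [mem_filter, mem_nb] at *
    exact ⟨hGF hu.1, hu.2⟩
  -- nonadjacent pair
  have hpair : ∃ u ∈ S, ∃ v ∈ S, u ≠ v ∧ ¬ F.Adj u v := by
    by_contra hc
    push Not at hc
    apply hF
    have e := S.equivFinOfCardEq hS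
    have hinj : ∀ i (hi : i < l) j (hj : j < l), (e.symm ⟨i, hi⟩ : V) = e.symm ⟨j, hj⟩ → i = j := by
      intro i hi j hj h
      have := e.symm.injective (Subtype.ext h)
      simpa using this
    refine ⟨fun i => if h : i < l then e.symm ⟨i, h⟩ else e.symm ⟨0, by omega⟩, ⟨?_, ?_, ?_⟩, ?_⟩
    · intro i hi j hj h
      simp only [hi, hj, dif_pos] at h
      exact hinj _ _ _ _ h
    · intro i hi
      simp only [hi, (by omega : i < l), dif_pos]
      apply hc _ (e.symm _).2 _ (e.symm _).2
      intro h
      have := hinj _ _ _ _ h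
      omega
    · simp only [(by omega : l - 1 < l), (by omega : 0 < l), dif_pos]
      apply hc _ (e.symm _).2 _ (e.symm _).2
      intro h
      have := hinj _ _ _ _ h
      omega
    · intro i hi
      simp only [hi, dif_pos]
      exact (e.symm _).2
  set P := (S ×ˢ S).filter (fun x => x.1 ≠ x.2 ∧ ¬ F.Adj x.1 x.2 ∧ dS F S x.1 ≤ dS F S x.2) with hP
  have memP : ∀ a b, (a, b) ∈ P ↔ (a ∈ S ∧ b ∈ S) ∧ a ≠ b ∧ ¬ F.Adj a b ∧ dS F S a ≤ dS F S b := by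
    intro a b; rw [hP, mem_filter, mem_product]
  have hPne : P.Nonempty := by
    obtain ⟨u, hu, v, hv, h1, h2⟩ := hpair
    rcases le_total (dS F S u) (dS F S v) with h | h
    · exact ⟨(u, v), (memP _ _).2 ⟨⟨hu, hv⟩, h1, h2, h⟩⟩
    · exact ⟨(v, u), (memP _ _).2 ⟨⟨hv, hu⟩, h1.symm, fun h => h2 h.symm, h⟩⟩
  obtain ⟨⟨u, v⟩, huv, hmx⟩ := exists_max_image P (fun x => dS F S x.1 + dS F S x.2) hPne
  obtain ⟨⟨hu, hv⟩, nuv, auv, duv⟩ := (memP _ _).1 huv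
  have hmx' : ∀ a ∈ S, ∀ b ∈ S, a ≠ b → ¬ F.Adj a b → dS F S a + dS F S b ≤ dS F S u + dS F S v := by
    intro a ha b hb h1 h2
    rcases le_total (dS F S a) (dS F S b) with h | h
    · exact hmx (a, b) ((memP _ _).2 ⟨⟨ha, hb⟩, h1, h2, h⟩)
    · have := hmx (b, a) ((memP _ _).2 ⟨⟨hb, ha⟩, h1.symm, fun h => h2 h.symm, h⟩)
      simp only at this; omega
  -- Hamiltonian path
  have hpath : ∃ p : ℕ → V, (∀ i < l, ∀ j < l, p i = p j → i = j) ∧ (∀ i < l, p i ∈ S) ∧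
      p 0 = u ∧ p (l-1) = v ∧ ∀ i, i + 1 < l → F.Adj (p i) (p (i+1)) := by
    have hadd : Cyc (addE F u v) S l := by
      by_contra hc
      have hle : F ≤ addE F u v := fun a b h => Or.inl h
      have := hmax.le_of_ge (y := addE F u v) hc hle
      exact auv (this (Or.inr ⟨nuv, Or.inl ⟨rfl, rfl⟩⟩))
    obtain ⟨p, hp, hpS⟩ := hadd
    have hex : ∃ j < l, ¬ F.Adj (p j) (p ((j+1)%l)) ∧ (addE F u v).Adj (p j) (p ((j+1)%l)) := by
      by_contra hc
      push Not at hc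
      apply hF
      refine ⟨p, ⟨hp.1, ?_, ?_⟩, hpS⟩
      · intro i hi
        by_contra h
        have := hc i (by omega) (by rw [Nat.mod_eq_of_lt hi]; exact h)
        rw [Nat.mod_eq_of_lt hi] at this
        exact this (hp.2.1 i hi)
      · by_contra h
        have e : (l - 1 + 1) % l = 0 := by rw [Nat.sub_add_cancel (by omega)]; simp
        have := hc (l-1) (by omega) (by rw [e]; exact h)
        rw [e] at this
        exact this hp.2.2
    obtain ⟨j, hj, hj1, hj2⟩ := hex
    obtain ⟨p', hp', e0, e1, hr, _⟩ := rot hp (by omega) hj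
    have hpS' : ∀ i < l, p' i ∈ S := by
      intro i hi; obtain ⟨i', hi', h⟩ := hr i hi; rw [h]; exact hpS _ hi'
    rw [← e0, ← e1] at hj1 hj2
    have key : ∀ r : ℕ → V, IsCy (addE F u v) l r → (∀ i < l, r i ∈ S) → r 0 = u → r (l-1) = v →
       ∃ p : ℕ → V, (∀ i < l, ∀ j < l, p i = p j → i = j) ∧ (∀ i < l, p i ∈ S) ∧
      p 0 = u ∧ p (l-1) = v ∧ ∀ i, i + 1 < l → F.Adj (p i) (p (i+1)) := by
      intro r hr hrS h0 h1
      refine ⟨r, hr.1, hrS, h0, h1, ?_⟩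
      intro i hi
      rcases hr.2.1 i hi with h | ⟨_, ⟨h2, h3⟩ | ⟨h2, h3⟩⟩
      · exact h
      · rw [← h0] at h2; rw [← h1] at h3
        have := hr.1 _ (by omega) _ (by omega) h2
        have := hr.1 _ (by omega) _ (by omega) h3
        omega
      · rw [← h1] at h2; rw [← h0] at h3
        have := hr.1 _ (by omega) _ (by omega) h2
        have := hr.1 _ (by omega) _ (by omega) h3
        omega
    rcases hj2 with h | ⟨_, ⟨h1, h2⟩ | ⟨h1, h2⟩⟩
    · exact absurd h hj1
    · refine key _ (hp'.rev (by omega)) (fun i hi => hpS' _ (by omega)) ?_ ?_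
      · simpa using h1
      · simpa using h2
    · exact key p' hp' hpS' h2 h1
  obtain ⟨p, hinj, hpS, h0, h1, hadj⟩ := hpath
  have hcross : ∀ j, j + 1 < l → F.Adj u (p (j+1)) → ¬ F.Adj v (p j) := by
    intro j hj ha hb
    apply hF
    refine ⟨fun i => if i ≤ j then p i else p (l + j - i), ⟨?_, ?_, ?_⟩, ?_⟩
    · intro a ha b hb hab
      simp only at hab
      split_ifs at hab
      · exact hinj _ ha _ hb hab
      · have := hinj _ ha _ (by omega) hab; omega
      · have := hinj _ (by omega) _ hb hab; omega
      · have := hinj _ (by omega) _ (by omega) hab; omega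
    · intro i hi
      simp only
      split_ifs with c1 c2
      · exact hadj i hi
      · have : i = j := by omega
        subst this
        rw [show l + i - (i+1) = l - 1 by omega, h1]
        exact hb.symm
      · omega
      · have := hadj (l + j - (i+1)) (by omega)
        rw [show l + j - (i+1) + 1 = l + j - i by omega] at this
        exact this.symm
    · simp only
      rw [if_neg (by omega), if_pos (by omega), h0, show l + j - (l - 1) = j + 1 by omega]
      exact ha.symm
    · intro i hi
      simp only
      split_ifs
      · exact hpS _ hi
      · exact hpS _ (by omega)
  have hsurj : ∀ x ∈ S, ∃ i < l, p i = x := by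
    have : (range l).image p = S := by
      apply eq_of_subset_of_card_le
      · intro x hx
        obtain ⟨i, hi, rfl⟩ := mem_image.1 hx
        exact hpS i (mem_range.1 hi)
      · rw [card_image_of_injOn, card_range, hS]
        intro a ha b hb hab
        exact hinj a (by simpa using ha) b (by simpa using hb) hab
    intro x hx
    rw [← this] at hx
    obtain ⟨i, hi, h⟩ := mem_image.1 hx
    exact ⟨i, mem_range.1 hi, h⟩
  set J := (range (l-1)).filter (fun j => F.Adj u (p (j+1))) with hJ
  set J' := (range (l-1)).filter (fun j => F.Adj v (p j)) with hJ'
  have cJ : dS F S u ≤ J.card := by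
    have : (nb F u).filter (· ∈ S) ⊆ J.image (fun j => p (j+1)) := by
      intro x hx
      rw [mem_filter, mem_nb] at hx
      obtain ⟨i, hi, rfl⟩ := hsurj x hx.2
      have : i ≠ 0 := by rintro rfl; exact hx.1.ne h0.symm
      refine mem_image.2 ⟨i-1, mem_filter.2 ⟨mem_range.2 (by omega), ?_⟩, ?_⟩
      · rw [Nat.sub_add_cancel (by omega)]; exact hx.1
      · rw [Nat.sub_add_cancel (by omega)]
    exact (card_le_card this).trans card_image_le
  have cJ' : dS F S v ≤ J'.card := by
    have : (nb F v).filter (· ∈ S) ⊆ J'.image p := by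
      intro x hx
      rw [mem_filter, mem_nb] at hx
      obtain ⟨i, hi, rfl⟩ := hsurj x hx.2
      have : i ≠ l-1 := by rintro rfl; exact hx.1.ne h1.symm
      exact mem_image.2 ⟨i, mem_filter.2 ⟨mem_range.2 (by omega), hx.1⟩, rfl⟩
    exact (card_le_card this).trans card_image_le
  have hdis : Disjoint J J' := by
    rw [disjoint_left]
    intro j hj hj'
    rw [mem_filter, mem_range] at *
    exact hcross j (by omega) hj.2 hj'.2
  have hcard : J.card + J'.card ≤ l - 1 := by
    rw [← card_union_of_disjoint hdis]
    have := card_le_card (union_subset (filter_subset _ _) (filter_subset _ _) : J ∪ J' ⊆ range (l-1))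
    simpa using this
  have hlow : J.card ≤ (S.filter (fun x => dS G S x ≤ dS F S u)).card := by
    rw [← card_image_of_injOn (s := J) (f := p)]
    · apply card_le_card
      intro x hx
      obtain ⟨j, hj, rfl⟩ := mem_image.1 hx
      rw [mem_filter, mem_range] at hj
      refine mem_filter.2 ⟨hpS _ (by omega), (hdeg _).trans ?_⟩
      have := hmx' (p j) (hpS _ (by omega)) v hv (by
        intro h; rw [← h1] at h; have := hinj _ (by omega) _ (by omega) h; omega)
        (fun h => hcross j (by omega) hj.2 h.symm)
      omega
    · intro a ha b hb hab
      have ha := mem_range.1 (mem_filter.1 ha).1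
      have hb := mem_range.1 (mem_filter.1 hb).1
      exact hinj a (by omega) b (by omega) hab
  by_cases hi : dS F S u = 0
  · have := H 1 le_rfl (by omega)
    have h2 : u ∈ S.filter (fun v => dS G S v ≤ 1) := mem_filter.2 ⟨hu, by have := hdeg u; omega⟩
    have := card_pos.2 ⟨u, h2⟩
    omega
  · have := H (dS F S u) (by omega) (by omega)
    omega

noncomputable def cnt (d : V → ℕ) (j : ℕ) : ℕ := (univ.filter (fun v => j ≤ d v)).card
def Pos (l : ℕ) (d : V → ℕ) : Prop := ∀ i, 1 ≤ i → 2 * i < l → l + 1 - i ≤ cnt d (i+1)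
noncomputable def supp (d : V → ℕ) : Finset V := univ.filter (fun v => 1 ≤ d v)

theorem mem_supp {d : V → ℕ} {v : V} : v ∈ supp d ↔ 1 ≤ d v := by simp [supp]

def Concl (l : ℕ) (d : V → ℕ) : Prop :=
  ∃ (G : SimpleGraph V) (S : Finset V), RL G d ∧ S.card = l ∧ ∀ r, 3 ≤ r → r ≤ l → Cyc G S r
def ConclF (l : ℕ) (d : V → ℕ) : Prop :=
  ∃ (G : SimpleGraph V) (S : Finset V), RL G d ∧ S.card = l ∧ ∃ a b, G.Adj a b ∧
    ∀ r, 3 ≤ r → r ≤ l → Cyc (delE G a b) S r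

theorem ConclF.concl {l : ℕ} {d : V → ℕ} (h : ConclF l d) : Concl l d := by
  obtain ⟨G, S, h1, h2, a, b, h3, h4⟩ := h
  exact ⟨G, S, h1, h2, fun r h5 h6 => Cyc.mono (G := delE G a b) (fun _ _ _ _ h => And.left h) (Subset.refl _) (by omega) (h4 r h5 h6)⟩

theorem adj_supp {G : SimpleGraph V} {d : V → ℕ} (h : RL G d) {a b : V} (hab : G.Adj a b) : 1 ≤ d a := by
  rw [← h a]; exact card_pos.2 ⟨b, mem_nb.2 hab⟩

theorem posa_supp {G : SimpleGraph V} {d : V → ℕ} {l : ℕ} (hl : 3 ≤ l) (hG : RL G d)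
    (hS : (supp d).card = l) (hP : Pos l d) : Cyc G (supp d) l := by
  apply posa hl hS
  intro i hi hi2
  have h1 : ∀ v, dS G (supp d) v = d v := by
    intro v
    rw [dS, filter_true_of_mem, hG v]
    intro u hu
    exact mem_supp.2 (adj_supp hG (mem_nb.1 hu).symm)
  simp only [h1]
  have h2 := hP i hi hi2
  have h3 : ((supp d).filter (fun v => d v ≤ i)).card + cnt d (i+1) = l := by
    rw [← hS, ← card_filter_add_card_filter_not (s := supp d) (fun v => d v ≤ i)]
    congr 1
    rw [cnt]; congr 1; ext v; simp [supp]; omega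
  omega

end C
end PT

set_option linter.all false
namespace PT
open Finset
open scoped Classical

section D
variable {V : Type} [Fintype V]

theorem shiftE {s u : V} (hsu : s ≠ u) (E : Finset V) : ∀ (H : SimpleGraph V) (d : V → ℕ), RL H d →
    (∀ x ∈ E, H.Adj s x ∧ ¬ H.Adj u x ∧ x ≠ u) →
    ∃ H', RL H' (fun v => d v - (if v = s then E.card else 0) + (if v = u then E.card else 0)) ∧
      ∀ a b, a ≠ s → b ≠ s → H.Adj a b → H'.Adj a b := by
  induction E using Finset.induction with
  | empty =>
    intro H d h _
    exact ⟨H, h.congr (by simp), fun _ _ _ _ h => h⟩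
  | insert x E hx ih =>
    intro H d h hE
    obtain ⟨h1, h2, h3⟩ := hE x (mem_insert_self _ _)
    have a1 := RL_delE h h1
    have a2 := RL_addE a1 h3.symm (fun hh => h2 hh.1)
    obtain ⟨H', hH', hp⟩ := ih _ _ a2 (by
      intro y hy
      obtain ⟨b1, b2, b3⟩ := hE y (mem_insert_of_mem hy)
      have hyx : y ≠ x := fun e => hx (e ▸ hy)
      refine ⟨Or.inl ⟨b1, ?_⟩, ?_, b3⟩
      · rintro (⟨_, hh⟩ | ⟨hh, _⟩)
        · exact hyx hh
        · exact h1.ne hh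
      · rintro (hh | ⟨_, ⟨_, hh⟩ | ⟨hh, _⟩⟩)
        · exact b2 hh.1
        · exact hyx hh
        · exact h3 hh.symm)
    refine ⟨H', hH'.congr ?_, ?_⟩
    · intro v
      rw [card_insert_of_notMem hx]
      have p2 := adj_supp h h1.symm
      have hxs := h1.ne
      by_cases c1 : v = s
      · subst c1; simp [hsu, hxs]; omega
      by_cases c2 : v = u
      · subst c2; simp [hsu.symm, h3.symm]; omega
      by_cases c3 : v = x
      · subst c3; simp [hxs.symm, h3]; omega
      simp [c1, c2, c3]
    · intro a b ha hb hab
      apply hp a b ha hb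
      refine Or.inl ⟨hab, ?_⟩
      rintro (⟨hh, _⟩ | ⟨_, hh⟩)
      · exact ha hh
      · exact hb hh

theorem GJL1 {G : SimpleGraph V} {d : V → ℕ} (h : RL G d) {s u : V} (hsu : s ≠ u) (hd : d s ≤ d u) :
    ∃ G', RL G' d ∧ ∀ a b, a ≠ s → b ≠ s → G.Adj (Equiv.swap s u a) (Equiv.swap s u b) → G'.Adj a b := by
  set σ := Equiv.swap s u with hσ
  have hH : RL (G.comap σ) (fun v => d (σ v)) := by
    intro v
    show _ = d (σ v); rw [← h (σ v)]
    have : nb G (σ v) = (nb (G.comap σ) v).map σ.toEmbedding := by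
      ext x
      rw [mem_map_equiv, mem_nb, mem_nb]
      simp
    rw [this, card_map]
  have e1 : d (σ s) = d u := by rw [hσ, Equiv.swap_apply_left]
  have e2 : d (σ u) = d s := by rw [hσ, Equiv.swap_apply_right]
  set H := G.comap σ with hHd
  have hc : d u - d s ≤ (((nb H s).erase u) \ ((nb H u).erase s)).card := by
    have h1 := le_card_sdiff ((nb H u).erase s) ((nb H s).erase u)
    have h2 : (nb H s).card = d (σ s) := hH s; have h3 : (nb H u).card = d (σ u) := hH u
    rw [e1] at h2; rw [e2] at h3
    by_cases ha : H.Adj s u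
    · rw [card_erase_of_mem (mem_nb.2 ha), card_erase_of_mem (mem_nb.2 ha.symm), h2, h3] at h1
      have : 1 ≤ d s := by rw [← h3]; exact card_pos.2 ⟨s, mem_nb.2 ha.symm⟩
      omega
    · rw [erase_eq_of_notMem (by rw [mem_nb]; exact ha), erase_eq_of_notMem (by rw [mem_nb]; exact fun h => ha h.symm)] at h1 ⊢
      omega
  obtain ⟨E, hE, hEc⟩ := exists_subset_card_eq hc
  obtain ⟨H', hH', hp⟩ := shiftE hsu E H _ hH (by
    intro x hx
    have := hE hx
    rw [mem_sdiff, mem_erase, mem_erase, mem_nb, mem_nb] at this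
    refine ⟨this.1.2, fun hh => this.2 ⟨this.1.2.ne.symm, hh⟩, this.1.1⟩)
  refine ⟨H', hH'.congr ?_, fun a b ha hb hab => hp a b ha hb hab⟩
  intro v
  rw [hEc]
  by_cases c1 : v = s
  · subst c1; simp [hsu, e1]; omega
  by_cases c2 : v = u
  · subst c2; simp [hsu.symm, e2]; omega
  simp [c1, c2, hσ, Equiv.swap_apply_of_ne_of_ne]

theorem GJL {G : SimpleGraph V} {d : V → ℕ} {S : Finset V} {k : ℕ} (h : RL G d)
    (hc : ∀ r, 3 ≤ r → r ≤ k → Cyc G S r) {s u : V} (hs : s ∈ S) (hu : u ∉ S) (hd : d s ≤ d u) :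
    ∃ G', RL G' d ∧ ∀ r, 3 ≤ r → r ≤ k → Cyc G' (insert u (S.erase s)) r := by
  have hsu : s ≠ u := fun e => hu (e ▸ hs)
  obtain ⟨G', h1, h2⟩ := GJL1 h hsu hd
  refine ⟨G', h1, fun r hr3 hrk => ?_⟩
  obtain ⟨p, ⟨p1, p2, p3⟩, p4⟩ := hc r hr3 hrk
  have hne : ∀ i < r, Equiv.swap s u (p i) ≠ s := by
    intro i hi hh
    have : p i = u := by
      have := congrArg (Equiv.swap s u) hh
      simpa using this
    exact hu (this ▸ p4 i hi)
  refine ⟨fun i => Equiv.swap s u (p i), ⟨?_, ?_, ?_⟩, ?_⟩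
  · intro i hi j hj hij
    exact p1 i hi j hj ((Equiv.swap s u).injective hij)
  · intro i hi
    apply h2 _ _ (hne _ (by omega)) (hne _ (by omega))
    simpa using p2 i hi
  · apply h2 _ _ (hne _ (by omega)) (hne _ (by omega))
    simpa using p3
  · intro i hi
    have h5 := p4 i hi
    have h6 : p i ≠ u := fun e => hu (e ▸ h5)
    by_cases e : p i = s
    · simp [e]
    · simp only [Equiv.swap_apply_of_ne_of_ne e h6]
      exact mem_insert_of_mem (mem_erase.2 ⟨e, h5⟩)

/-- swap until a prescribed set `D` of large-degree vertices is included -/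
theorem GJL_many {d : V → ℕ} {k : ℕ} (D : Finset V) (N : ℕ) : ∀ (G : SimpleGraph V) (S : Finset V), RL G d →
    (∀ r, 3 ≤ r → r ≤ k → Cyc G S r) → (D \ S).card ≤ N →
    (∀ S' : Finset V, S'.card = S.card → ¬ D ⊆ S' → ∃ s ∈ S', s ∉ D ∧ ∀ u ∈ D, d s ≤ d u) →
    ∃ (G' : SimpleGraph V) (S' : Finset V), RL G' d ∧ (∀ r, 3 ≤ r → r ≤ k → Cyc G' S' r) ∧ S'.card = S.card ∧ D ⊆ S' := by
  induction N with
  | zero =>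
    intro G S h1 h2 h3 h4
    refine ⟨G, S, h1, h2, rfl, ?_⟩
    rw [← sdiff_eq_empty_iff_subset, ← card_eq_zero]; omega
  | succ N ih =>
    intro G S h1 h2 h3 h4
    by_cases hD : D ⊆ S
    · exact ⟨G, S, h1, h2, rfl, hD⟩
    obtain ⟨s, hs, hsD, hsu⟩ := h4 S rfl hD
    obtain ⟨u, huD, huS⟩ := not_subset.1 hD
    obtain ⟨G', h5, h6⟩ := GJL h1 h2 hs huS (hsu u huD)
    have hcard : (insert u (S.erase s)).card = S.card := by
      rw [card_insert_of_notMem (fun h => huS (mem_erase.1 h).2), card_erase_of_mem hs]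
      have := card_pos.2 ⟨s, hs⟩; omega
    obtain ⟨G2, S2, g1, g2, g3, g4⟩ := ih G' (insert u (S.erase s)) h5 h6 (by
      have : D \ (insert u (S.erase s)) ⊆ (D \ S).erase u := by
        intro x hx
        rw [mem_sdiff, mem_insert, mem_erase, not_or] at hx
        rw [mem_erase, mem_sdiff]
        refine ⟨hx.2.1, hx.1, fun hh => hx.2.2 ⟨fun e => hsD (e ▸ hx.1), hh⟩⟩
      have := card_le_card this
      rw [card_erase_of_mem (mem_sdiff.2 ⟨huD, huS⟩)] at this
      omega) (by rw [hcard]; exact h4)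
    exact ⟨G2, S2, g1, g2, g3.trans hcard, g4⟩

end D
end PT

set_option linter.all false
namespace PT
open Finset

/-- adjacency given by an edge list -/
def eAdj (E : List (ℕ × ℕ)) (i j : ℕ) : Bool := E.contains (i, j) || E.contains (j, i)

/-- `c` is a cycle of length `r` inside `T`. -/
def cOk (E : List (ℕ × ℕ)) (T : List ℕ) (r : ℕ) (c : List ℕ) : Prop :=
  (∀ i < r, ∀ j < r, c.getD i 0 = c.getD j 0 → i = j) ∧
    (∀ i < r - 1, eAdj E (c.getD i 0) (c.getD (i+1) 0) = true) ∧
    eAdj E (c.getD (r-1) 0) (c.getD 0 0) = true ∧ ∀ i < r, c.getD i 0 ∈ T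

instance (E T r c) : Decidable (cOk E T r c) := by unfold cOk; infer_instance

/-- `E` together with the extra edge `ab` realizes the list `g`, and `C` lists cycles of
lengths `3, …, l` using edges of `E` only, all inside the set of vertices listed in `T`. -/
def chk (g : List ℕ) (l : ℕ) (E : List (ℕ × ℕ)) (a b : ℕ) (C : List (List ℕ)) (T : List ℕ) : Prop :=
  a < g.length ∧ b < g.length ∧ a ≠ b ∧ eAdj E a b = false ∧
  (∀ i < g.length, eAdj E i i = false) ∧
  (∀ i < g.length, ((List.range g.length).filter (eAdj ((a, b) :: E) i)).length = g.getD i 0) ∧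
  (∀ i ∈ T, i < g.length) ∧ T.Nodup ∧
  (∀ r < l + 1, 3 ≤ r → cOk E T r (C.getD (r-3) []))

instance (g l E a b C T) : Decidable (chk g l E a b C T) := by unfold chk; infer_instance


theorem eAdj_symm (E : List (ℕ × ℕ)) (i j : ℕ) : eAdj E i j = eAdj E j i := by
  unfold eAdj; rw [Bool.or_comm]

theorem eAdj_cons (E : List (ℕ × ℕ)) (a b i j : ℕ) :
    eAdj ((a, b) :: E) i j = true ↔ eAdj E i j = true ∨ (i = a ∧ j = b) ∨ (i = b ∧ j = a) := by
  unfold eAdj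
  simp only [List.contains_cons, Bool.or_eq_true, beq_iff_eq, Prod.mk.injEq]
  tauto

open scoped Classical
section Ex
variable {V : Type} [Fintype V]

def expG (L : List V) (E : List (ℕ × ℕ)) : SimpleGraph V where
  Adj u v := u ≠ v ∧ ∃ i j, ∃ (hi : i < L.length) (hj : j < L.length), u = L[i] ∧ v = L[j] ∧ eAdj E i j = true
  symm := ⟨by
    rintro u v ⟨hne, i, j, hi, hj, h1, h2, h3⟩
    exact ⟨hne.symm, j, i, hj, hi, h2, h1, by rw [eAdj_symm]; exact h3⟩⟩
  loopless := ⟨fun u h => h.1 rfl⟩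

theorem explicit {d : V → ℕ} {L : List V} (hnd : L.Nodup) (hmem : ∀ v, 1 ≤ d v → v ∈ L)
    {g : List ℕ} (hg : L.map d = g)
    {l : ℕ} {E : List (ℕ × ℕ)} {a b : ℕ} {C : List (List ℕ)} {T : List ℕ} (h : chk g l E a b C T) :
    ∃ (G : SimpleGraph V) (S : Finset V), RL G d ∧ S.card = T.length ∧ ∃ a b, G.Adj a b ∧
    ∀ r, 3 ≤ r → r ≤ l → Cyc (delE G a b) S r := by
  have hlen : g.length = L.length := by rw [← hg]; simp
  obtain ⟨ha, hb, hab, hEab, hirr, hdeg, hT, hTn, hC⟩ := h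
  rw [hlen] at ha hb hirr hdeg hT
  have hinj : ∀ {i j} (hi : i < L.length) (hj : j < L.length), L[i] = L[j] → i = j := by
    intro i j hi hj h; exact (List.Nodup.getElem_inj_iff hnd).1 h
  have hgd : ∀ i (hi : i < L.length), g.getD i 0 = d L[i] := by
    intro i hi; subst hg; simp [List.getD, hi]
  have hadj : ∀ i j (hi : i < L.length) (hj : j < L.length), (expG L ((a,b)::E)).Adj L[i] L[j] ↔ eAdj ((a,b)::E) i j = true := by
    intro i j hi hj
    constructor
    · rintro ⟨_, i', j', hi', hj', h1, h2, h3⟩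
      rw [hinj hi hi' h1, hinj hj hj' h2]; exact h3
    · intro h
      refine ⟨?_, i, j, hi, hj, rfl, rfl, h⟩
      intro e
      have := hinj _ _ e
      subst this
      rw [eAdj_cons] at h
      rcases h with h | h | h
      · rw [hirr i hi] at h; exact absurd h (by simp)
      · omega
      · omega
  refine ⟨expG L ((a,b)::E), (T.map (fun i => L.getD i L[a])).toFinset, ?_, ?_, L[a], L[b], ?_, ?_⟩
  · intro v
    by_cases hv : v ∈ L
    · obtain ⟨i, hi, rfl⟩ := List.getElem_of_mem hv
      rw [← hgd i hi, ← hdeg i hi]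
      have : nb (expG L ((a,b)::E)) L[i] = (((List.range L.length).filter (eAdj ((a, b) :: E) i)).map (fun j => L.getD j L[a])).toFinset := by
        ext u
        rw [mem_nb, List.mem_toFinset, List.mem_map]
        constructor
        · intro hu
          have hu' := hu
          obtain ⟨_, _, j, _, hj, _, rfl, _⟩ := hu
          refine ⟨j, ?_, by simp [List.getD, hj]⟩
          rw [List.mem_filter, List.mem_range]
          exact ⟨hj, (hadj i j hi hj).1 hu'⟩
        · rintro ⟨j, hj, rfl⟩
          rw [List.mem_filter, List.mem_range] at hj
          have : L.getD j L[a] = L[j] := by simp [List.getD, hj.1]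
          rw [this]
          exact (hadj i j hi hj.1).2 hj.2
      rw [this, List.toFinset_card_of_nodup, List.length_map]
      refine List.Nodup.map_on ?_ (List.Nodup.filter _ List.nodup_range)
      intro x hx y hy hxy
      rw [List.mem_filter, List.mem_range] at hx hy
      simp only [List.getD, hx.1, hy.1, List.getElem?_eq_getElem, Option.getD_some] at hxy
      exact hinj _ _ hxy
    · have h0 : d v = 0 := by by_contra h; exact hv (hmem v (by omega))
      rw [h0, card_eq_zero, eq_empty_iff_forall_notMem]
      intro u hu
      rw [mem_nb] at hu
      obtain ⟨_, i, _, hi, _, rfl, _⟩ := hu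
      exact hv (List.getElem_mem hi)
  · rw [List.toFinset_card_of_nodup, List.length_map]
    refine List.Nodup.map_on ?_ hTn
    intro x hx y hy hxy
    simp only [List.getD, hT x hx, hT y hy, List.getElem?_eq_getElem, Option.getD_some] at hxy
    exact hinj _ _ hxy
  · rw [hadj, eAdj_cons]; simp
  · intro r hr hr2
    obtain ⟨c1, c2, c3, c4⟩ := hC r (by omega) hr
    generalize C.getD (r-3) [] = c at c1 c2 c3 c4
    have hlt : ∀ i < r, c.getD i 0 < L.length := fun i hi => hT _ (c4 i hi)
    have hadj' : ∀ i j (hi : i < L.length) (hj : j < L.length), eAdj E i j = true →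
        (delE (expG L ((a,b)::E)) L[a] L[b]).Adj L[i] L[j] := by
      intro i j hi hj h
      refine ⟨(hadj i j hi hj).2 ((eAdj_cons _ _ _ _ _).2 (Or.inl h)), ?_⟩
      rintro (⟨h1, h2⟩ | ⟨h1, h2⟩)
      · rw [hinj _ _ h1, hinj _ _ h2, hEab] at h; exact absurd h (by simp)
      · rw [hinj _ _ h1, hinj _ _ h2, eAdj_symm, hEab] at h; exact absurd h (by simp)
    have hp : ∀ i (hi : i < r), L.getD (c.getD i 0) L[a] = L[c.getD i 0]'(hlt i hi) := by
      intro i hi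
      rw [List.getD_eq_getElem _ _ (hlt i hi)]
    refine ⟨fun i => L.getD (c.getD i 0) L[a], ⟨?_, ?_, ?_⟩, ?_⟩
    · intro i hi j hj hij
      simp only at hij
      rw [hp i hi, hp j hj] at hij
      exact c1 i hi j hj (hinj _ _ hij)
    · intro i hi
      simp only
      rw [hp i (by omega), hp (i+1) hi]
      exact hadj' _ _ _ _ (c2 i (by omega))
    · simp only
      rw [hp (r-1) (by omega), hp 0 (by omega)]
      exact hadj' _ _ _ _ c3
    · intro i hi
      rw [List.mem_toFinset, List.mem_map]
      exact ⟨_, c4 i hi, rfl⟩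

theorem explicitF {d : V → ℕ} {L : List V} (hnd : L.Nodup) (hmem : ∀ v, 1 ≤ d v → v ∈ L)
    {g : List ℕ} (hg : L.map d = g)
    {l : ℕ} {E : List (ℕ × ℕ)} {a b : ℕ} {C : List (List ℕ)} {T : List ℕ} (h : chk g l E a b C T)
    (hT : T.length = l) : ConclF l d := by
  obtain ⟨G, S, h1, h2, h3⟩ := explicit hnd hmem hg h
  exact ⟨G, S, h1, h2.trans hT, h3⟩

theorem map_const {d : V → ℕ} {c k : ℕ} {A : Finset V} (h : ∀ v ∈ A, d v = c) (hk : A.card = k) :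
    A.toList.map d = List.replicate k c := by
  rw [List.eq_replicate_iff]
  constructor
  · simp [hk]
  · intro b hb
    rw [List.mem_map] at hb
    obtain ⟨v, hv, rfl⟩ := hb
    exact h v (by simpa using hv)

noncomputable def num (d : V → ℕ) (j : ℕ) : ℕ := (univ.filter (fun v => d v = j)).card

theorem lst (d : V → ℕ) : ∃ Qs L : List V, Qs.Nodup ∧ (∀ v, v ∈ Qs ↔ 4 ≤ d v) ∧ L.Nodup ∧ (∀ v, 1 ≤ d v → v ∈ L) ∧
    L.map d = Qs.map d ++ (List.replicate (num d 3) 3 ++ (List.replicate (num d 2) 2 ++ List.replicate (num d 1) 1)) ∧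
    ∑ v, d v = (Qs.map d).sum + 3 * num d 3 + 2 * num d 2 + num d 1 ∧ cnt d 4 = Qs.length ∧
    cnt d 3 = cnt d 4 + num d 3 ∧ cnt d 2 = cnt d 3 + num d 2 ∧ cnt d 1 = cnt d 2 + num d 1 := by
  set Q := univ.filter (fun v => 4 ≤ d v) with hQ
  set A3 := univ.filter (fun v => d v = 3) with h3
  set A2 := univ.filter (fun v => d v = 2) with h2
  set A1 := univ.filter (fun v => d v = 1) with h1
  have hc : ∀ j, cnt d j = cnt d (j+1) + num d j := by
    intro j
    unfold cnt num
    rw [← card_union_of_disjoint]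
    · congr 1; ext v; simp; omega
    · rw [disjoint_left]; intro v hv hv2; simp at hv hv2; omega
  have hmap : (Q.toList ++ (A3.toList ++ (A2.toList ++ A1.toList))).map d = Q.toList.map d ++ (List.replicate (num d 3) 3 ++ (List.replicate (num d 2) 2 ++ List.replicate (num d 1) 1)) := by
    rw [List.map_append, List.map_append, List.map_append, map_const (A := A3) (c := 3) (k := num d 3) (by simp [h3]) rfl,
      map_const (A := A2) (c := 2) (k := num d 2) (by simp [h2]) rfl, map_const (A := A1) (c := 1) (k := num d 1) (by simp [h1]) rfl]
  have hnd : (Q.toList ++ (A3.toList ++ (A2.toList ++ A1.toList))).Nodup := by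
    refine List.Nodup.append (nodup_toList _) (List.Nodup.append (nodup_toList _) (List.Nodup.append (nodup_toList _) (nodup_toList _) ?_) ?_) ?_
    all_goals
      intro v hv hv2
      simp [hQ, h1, h2, h3] at hv hv2
      omega
  have hmem : ∀ v, 1 ≤ d v → v ∈ Q.toList ++ (A3.toList ++ (A2.toList ++ A1.toList)) := by
    intro v hv
    simp [hQ, h1, h2, h3]; omega
  refine ⟨Q.toList, _, nodup_toList _, by simp [hQ], hnd, hmem, hmap, ?_, by simp [hQ, cnt], hc 3, hc 2, hc 1⟩
  have : ∑ v, d v = ∑ v ∈ (Q.toList ++ (A3.toList ++ (A2.toList ++ A1.toList))).toFinset, d v := by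
    symm
    apply sum_subset (subset_univ _)
    intro v _ hv
    by_contra h
    exact hv (List.mem_toFinset.2 (hmem v (by omega)))
  rw [this, List.sum_toFinset _ hnd, hmap]
  simp; omega

end Ex
end PT

set_option linter.all false
namespace PT
open Finset
open scoped Classical

section E
variable {V : Type} [Fintype V]

noncomputable def lay (d : V → ℕ) (w : V) (W : Finset V) : V → ℕ :=
  fun v => if v = w then 0 else d v - (if v ∈ W then 1 else 0)

theorem lay_back {d : V → ℕ} {w : V} {W : Finset V} (hw : w ∉ W) (hc : W.card = d w)
    (h1 : ∀ v ∈ W, 1 ≤ d v) (v : V) :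
    lay d w W v + (if v ∈ W then 1 else 0) + (if v = w then W.card else 0) = d v := by
  unfold lay
  by_cases e : v = w
  · subst e; simp [hw, hc]
  · by_cases e2 : v ∈ W
    · have := h1 v e2
      simp [e, e2]; omega
    · simp [e, e2]

theorem lay_sum {d : V → ℕ} {w : V} {W : Finset V} (hw : w ∉ W) (hc : W.card = d w)
    (h1 : ∀ v ∈ W, 1 ≤ d v) : ∑ v, d v = ∑ v, lay d w W v + 2 * d w := by
  rw [← sum_congr rfl (fun v _ => lay_back hw hc h1 v), sum_add_distrib, sum_add_distrib]
  simp [hc]; omega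

theorem cnt_anti (d : V → ℕ) {i j : ℕ} (h : i ≤ j) : cnt d j ≤ cnt d i := by
  apply card_le_card; intro v hv; simp at *; omega

theorem supp_card (d : V → ℕ) : (supp d).card = cnt d 1 := rfl

theorem cnt_min {d : V → ℕ} {w : V} (hm : ∀ v, 1 ≤ d v → d w ≤ d v) {j : ℕ} (hj : j ≤ d w) :
    cnt d 1 ≤ cnt d j := by
  apply card_le_card; intro v hv; simp at *; exact hj.trans (hm v hv)

theorem cnt_lay {d : V → ℕ} {w : V} {W : Finset V} (j : ℕ) (hj : 1 ≤ j) :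
    cnt d j ≤ cnt (lay d w W) j + (if j ≤ d w then 1 else 0) + (W.filter (fun v => d v = j)).card := by
  have : univ.filter (fun v => j ≤ d v) ⊆ (univ.filter (fun v => j ≤ lay d w W v)) ∪
      (if j ≤ d w then {w} else ∅) ∪ (W.filter (fun v => d v = j)) := by
    intro v hv
    simp only [mem_filter, mem_univ, true_and, mem_union] at *
    by_cases e : v = w
    · subst e; simp [hv]
    · by_cases e2 : v ∈ W
      · by_cases e3 : d v = j
        · simp [e2, e3]
        · left; left; simp [lay, e, e2]; omega
      · left; left; simp [lay, e, e2]; omega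
  refine (card_le_card this).trans ((card_union_le _ _).trans ?_)
  gcongr
  refine (card_union_le _ _).trans ?_
  gcongr
  · rfl
  · split_ifs <;> simp

theorem cnt_lay' {d : V → ℕ} {w : V} {W : Finset V} (j : ℕ) :
    cnt d (j+1) ≤ cnt (lay d w W) j + (if j + 1 ≤ d w then 1 else 0) := by
  have : univ.filter (fun v => j + 1 ≤ d v) ⊆ (univ.filter (fun v => j ≤ lay d w W v)) ∪
      (if j + 1 ≤ d w then {w} else ∅) := by
    intro v hv
    simp only [mem_filter, mem_univ, true_and, mem_union] at *
    by_cases e : v = w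
    · subst e; simp [hv]
    · left; simp only [lay, e, if_false]; split_ifs <;> omega
  refine (card_le_card this).trans ((card_union_le _ _).trans ?_)
  gcongr
  · rfl
  · split_ifs <;> simp

theorem deg_lt {G : SimpleGraph V} {d : V → ℕ} (h : RL G d) {v : V} (hv : 1 ≤ d v) : d v < cnt d 1 := by
  have h1 : nb G v ⊆ (supp d).erase v := by
    intro u hu
    rw [mem_nb] at hu
    exact mem_erase.2 ⟨hu.ne.symm, mem_supp.2 (adj_supp h hu.symm)⟩
  have h2 := card_le_card h1
  rw [h, card_erase_of_mem (mem_supp.2 hv), supp_card] at h2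
  have : 0 < cnt d 1 := card_pos.2 ⟨v, mem_supp.2 hv⟩
  omega

theorem Cyc.supp {G : SimpleGraph V} {d : V → ℕ} {S : Finset V} {r : ℕ} (h : RL G d) (hr : 2 ≤ r)
    (hc : Cyc G S r) : Cyc G (supp d) r := by
  obtain ⟨p, hp, hS⟩ := hc
  refine ⟨p, hp, fun i hi => ?_⟩
  obtain ⟨u, hu⟩ := Cyc.pos (G := G) (S := S) hr hp hi
  exact mem_supp.2 (adj_supp h hu)

theorem noadj {G : SimpleGraph V} {d : V → ℕ} (h : RL G d) {w : V} (hw : d w = 0) (u : V) : ¬ G.Adj w u := by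
  intro hh; have := adj_supp h hh; omega

/-- the exceptional case `3^8`, `l = 6` -/
def Exc (l : ℕ) (d : V → ℕ) : Prop := l = 6 ∧ cnt d 1 = 8 ∧ ∀ v, 1 ≤ d v → d v = 3

def IHyp (V : Type) [Fintype V] (N : ℕ) : Prop :=
  ∀ (l : ℕ) (d : V → ℕ), ∑ v, d v < N → 5 ≤ l → Pos l d → gr d → ¬ Exc l d → Concl l d

theorem star_RL {d : V → ℕ} {w : V} {W : Finset V} (hw : w ∉ W) (hc : W.card = d w)
    (h1 : ∀ v ∈ W, 1 ≤ d v) {G : SimpleGraph V} (hG : RL G (lay d w W)) : RL (star G w W) d :=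
  (RL_star hG hw (fun u _ => noadj hG (by simp [lay]) u)).congr (lay_back hw hc h1)

theorem layoff {d : V → ℕ} {l : ℕ} (ih : IHyp V (∑ v, d v)) (hl : 5 ≤ l) {w : V} {W : Finset V}
    (hw : w ∉ W) (hc : W.card = d w) (h1 : ∀ v ∈ W, 1 ≤ d v) (hw1 : 1 ≤ d w)
    (hg : gr (lay d w W)) (hp : Pos l (lay d w W)) (hx : ¬ Exc l (lay d w W)) : ConclF l d := by
  have hs := lay_sum hw hc h1
  obtain ⟨G, S, g1, g2, g3⟩ := ih l _ (by omega) hl hp hg hx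
  obtain ⟨b, hb⟩ := card_pos.1 (by omega : 0 < W.card)
  have hwb : w ≠ b := fun e => hw (e ▸ hb)
  refine ⟨star G w W, S, star_RL hw hc h1 g1, g2, w, b, Or.inr ⟨hwb, Or.inl ⟨rfl, hb⟩⟩, ?_⟩
  intro r hr hr2
  refine (g3 r hr hr2).mono ?_ (Subset.refl _) (by omega)
  intro x _ y _ hxy
  refine ⟨Or.inl hxy, ?_⟩
  have hn : ∀ z, ¬ G.Adj w z := noadj g1 (by simp [lay])
  rintro (⟨rfl, rfl⟩ | ⟨rfl, rfl⟩)
  · exact hn _ hxy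
  · exact hn _ hxy.symm

theorem layoff' {d : V → ℕ} {l : ℕ} (ih : IHyp V (∑ v, d v)) (hl : 6 ≤ l) (hP : Pos l d) {w : V} {W : Finset V}
    (hn : cnt d 1 = l)
    (hw : w ∉ W) (hc : W.card = d w) (h1 : ∀ v ∈ W, 1 ≤ d v) (hw1 : 1 ≤ d w)
    (hg : gr (lay d w W)) (hp : Pos (l-1) (lay d w W)) : Concl l d := by
  have hs := lay_sum hw hc h1
  obtain ⟨G, S, g1, g2, g3⟩ := ih (l-1) _ (by omega) (by omega) hp hg (by
    rintro ⟨e1, e2, _⟩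
    have : cnt (lay d w W) 1 ≤ cnt d 1 := by
      apply card_le_card; intro v hv
      rw [mem_filter] at *
      refine ⟨mem_univ _, hv.2.trans ?_⟩
      unfold lay
      split_ifs <;> omega
    omega)
  have hG := star_RL hw hc h1 g1
  refine ⟨star G w W, supp d, hG, hn, ?_⟩
  intro r hr hr2
  by_cases e : r = l
  · subst e; exact posa_supp (by omega) hG hn hP
  · apply Cyc.supp hG (by omega)
    exact (g3 r hr (by omega)).mono (fun x _ y _ hxy => Or.inl hxy) (Subset.refl _) (by omega)

theorem layRL {G : SimpleGraph V} {d : V → ℕ} (h : RL G d) (w : V) : RL (delV G w) (lay d w (nb G w)) :=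
  RL_delV h w

/-- case C1 -/
theorem highs_first {d : V → ℕ} {w : V} {Q : Finset V} (hQ : d w ≤ Q.card) (hwQ : w ∉ Q)
    (hQd : ∀ h ∈ Q, ∀ b, b ∉ Q → d b < d h) (k : ℕ) : ∀ G : SimpleGraph V, RL G d → (nb G w \ Q).card ≤ k →
    ∃ G' : SimpleGraph V, RL G' d ∧ nb G' w ⊆ Q := by
  induction k with
  | zero =>
    intro G h hk
    refine ⟨G, h, ?_⟩
    rw [← sdiff_eq_empty_iff_subset, ← card_eq_zero]; omega
  | succ k ih =>
    intro G h hk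
    by_cases hs : nb G w ⊆ Q
    · exact ⟨G, h, hs⟩
    obtain ⟨b, hb, hbQ⟩ := not_subset.1 hs
    have hb := mem_nb.1 hb
    obtain ⟨x, hx, hwx⟩ : ∃ x ∈ Q, ¬ G.Adj w x := by
      by_contra hc; push Not at hc
      have h1 : insert b Q ⊆ nb G w := by
        intro y hy
        rcases mem_insert.1 hy with rfl | hy
        · exact mem_nb.2 hb
        · exact mem_nb.2 (hc y hy)
      have := card_le_card h1
      rw [h, card_insert_of_notMem hbQ] at this
      omega
    have hxb : x ≠ b := fun e => hbQ (e ▸ hx)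
    obtain ⟨f, f1, f2, f3⟩ := exists_priv h hxb (hQd x hx b hbQ)
    have hwx' : w ≠ x := fun e => hwQ (e ▸ hx)
    have hsw := switch h hb f1 hwx f2 hwx' f3.symm
    refine ih _ hsw ?_
    have hfw : f ≠ w := by rintro rfl; exact f2 hb.symm
    have : nb (addE (addE (delE (delE G w b) x f) w x) b f) w \ Q ⊆ (nb G w \ Q).erase b := by
      intro y hy
      rw [mem_sdiff, mem_nb] at hy
      obtain ⟨hy, hyQ⟩ := hy
      rw [mem_erase, mem_sdiff, mem_nb]
      rcases hy with (⟨⟨h1, h2⟩, _⟩ | ⟨_, ⟨_, h1⟩ | ⟨h1, _⟩⟩) | ⟨_, ⟨h1, _⟩ | ⟨h1, _⟩⟩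
      · exact ⟨fun e => h2 (Or.inl ⟨rfl, e⟩), h1, hyQ⟩
      · exact absurd hx (h1 ▸ hyQ)
      · exact absurd h1 hwx'
      · exact absurd h1 hb.ne
      · exact absurd h1.symm hfw
    have h3 := card_le_card this
    rw [card_erase_of_mem (mem_sdiff.2 ⟨mem_nb.2 hb, hbQ⟩)] at h3
    omega

theorem Pos_n {d : V → ℕ} {l : ℕ} (hl : 5 ≤ l) (hP : Pos l d) : l ≤ cnt d 1 := by
  have h1 := hP 1 le_rfl (by omega)
  have := cnt_anti d (show 1 ≤ 1 + 1 by omega)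
  omega

theorem preExc {d : V → ℕ} {l : ℕ} {w : V} {W : Finset V} (hx : Exc l (lay d w W)) (hw : w ∉ W)
    (hc : W.card = d w) (hw1 : 1 ≤ d w) (hmin : ∀ v, 1 ≤ d v → d w ≤ d v) (hW : ∀ v ∈ W, 4 ≤ d v) : ConclF l d := by
  obtain ⟨rfl, h8, h3⟩ := hx
  have h4 : ∀ v ∈ W, d v = 4 := by
    intro v hv
    have h1 := hW v hv
    have h2 : lay d w W v = d v - 1 := by simp [lay, hv, show v ≠ w from fun e => hw (e ▸ hv)]
    have := h3 v (by omega)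
    omega
  set B := ((supp d).erase w) \ W with hB
  have hBd : ∀ v, v ∈ B ↔ v ≠ w ∧ 1 ≤ d v ∧ v ∉ W := by
    intro v; rw [hB, mem_sdiff, mem_erase, mem_supp, and_assoc]
  have hB3 : ∀ v ∈ B, d v = 3 := by
    intro v hv
    rw [hBd] at hv
    have h2 : lay d w W v = d v := by simp [lay, hv.1, hv.2.2]
    have := h3 v (by omega)
    omega
  have hcard : W.card + B.card = 8 := by
    rw [← h8, ← card_union_of_disjoint]
    · unfold cnt; congr 1; ext v
      rw [mem_union, hBd, mem_filter]
      by_cases e : v = w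
      · subst e; simp [lay, hw]
      · by_cases e2 : v ∈ W
        · have := h4 v e2; simp [lay, e, e2]; omega
        · simp [lay, e, e2]
    · rw [disjoint_right]; intro v hv; exact ((hBd v).1 hv).2.2
  have ht : d w ≤ 3 := by
    by_cases hBe : B.card = 0
    · exfalso
      obtain ⟨u, hu⟩ := card_pos.1 (show 0 < W.card by omega)
      have := hmin u (by have := h4 u hu; omega)
      have := h4 u hu
      omega
    · obtain ⟨u, hu⟩ := card_pos.1 (Nat.pos_of_ne_zero hBe)
      have h1 := hmin u ((hBd u).1 hu).2.1
      have := hB3 u hu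
      omega
  have hmap : (W.toList ++ (B.toList ++ [w])).map d = List.replicate (d w) 4 ++ (List.replicate (8 - d w) 3 ++ [d w]) := by
    rw [List.map_append, List.map_append, map_const h4 hc, map_const hB3 (show B.card = 8 - d w by omega)]; rfl
  have hnd : (W.toList ++ (B.toList ++ [w])).Nodup := by
    refine List.Nodup.append (nodup_toList _) (List.Nodup.append (nodup_toList _) (List.nodup_singleton _) ?_) ?_
    · intro v hv hv2
      simp only [mem_toList, List.mem_singleton] at hv hv2
      exact ((hBd v).1 hv).1 hv2
    · intro v hv hv2
      simp only [mem_toList, List.mem_append, List.mem_singleton] at hv hv2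
      rcases hv2 with h | h
      · exact ((hBd v).1 h).2.2 hv
      · exact hw (h ▸ hv)
  have hmem : ∀ v, 1 ≤ d v → v ∈ W.toList ++ (B.toList ++ [w]) := by
    intro v hv
    simp only [mem_toList, List.mem_append, List.mem_singleton, hBd]; tauto
  generalize d w = t at *
  interval_cases t
  · exact explicitF hnd hmem hmap (E := [(0, 2), (0, 4), (0, 5), (1, 3), (1, 4), (1, 5), (2, 4), (2, 7), (3, 5), (3, 6), (6, 7), (6, 8)]) (a := 0) (b := 7) (C := [[0, 2, 4], [0, 4, 1, 5], [0, 2, 4, 1, 5], [0, 2, 4, 1, 3, 5]]) (T := [0, 2, 4, 1, 3, 5]) (by decide) rfl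
  · exact explicitF hnd hmem hmap (E := [(0, 5), (0, 7), (0, 8), (1, 3), (1, 4), (1, 5), (2, 3), (2, 4), (2, 6), (3, 5), (4, 6), (6, 7), (7, 8)]) (a := 0) (b := 1) (C := [[1, 3, 5], [1, 3, 2, 4], [1, 4, 2, 3, 5], [1, 4, 6, 2, 3, 5]]) (T := [1, 4, 6, 2, 3, 5]) (by decide) rfl
  · exact explicitF hnd hmem hmap (E := [(0, 2), (0, 6), (0, 8), (1, 2), (1, 3), (1, 6), (2, 6), (2, 7), (3, 5), (3, 7), (4, 5), (4, 7), (4, 8), (5, 8)]) (a := 0) (b := 1) (C := [[0, 2, 6], [0, 2, 1, 6], [1, 3, 7, 2, 6], [0, 2, 7, 3, 1, 6]]) (T := [0, 2, 7, 3, 1, 6]) (by decide) rfl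

theorem caseC1 {d : V → ℕ} {l m : ℕ} (ih : IHyp V (∑ v, d v)) (hl : 5 ≤ l) (hm : (l - 1) / 2 = m)
    (hP : Pos l d) (hg : gr d) {w : V} (hw1 : 1 ≤ d w) (hmin : ∀ v, 1 ≤ d v → d w ≤ d v)
    (hq : d w ≤ cnt d (m+2)) (h55 : ¬ (l = 5 ∧ cnt d 1 = 5)) : Concl l d := by
  have hn := Pos_n hl hP
  set Q := univ.filter (fun v => m + 2 ≤ d v) with hQ
  obtain ⟨G, hG, hGQ⟩ : ∃ G : SimpleGraph V, RL G d ∧ nb G w ⊆ Q := by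
    obtain ⟨G, hG⟩ := hg
    by_cases hwQ : w ∈ Q
    · refine ⟨G, hG, ?_⟩
      intro u hu
      have h1 := adj_supp hG (mem_nb.1 hu).symm
      have h2 := hmin u h1
      simp [hQ] at hwQ ⊢; omega
    · refine highs_first hq hwQ ?_ _ G hG le_rfl
      intro h hh b hb
      simp [hQ] at hh hb; omega
  have hgr : gr (lay d w (nb G w)) := ⟨_, layRL hG w⟩
  have hww : w ∉ nb G w := by rw [mem_nb]; exact G.loopless.irrefl w
  have hW1 : ∀ v ∈ nb G w, 1 ≤ d v := fun v hv => adj_supp hG (mem_nb.1 hv).symm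
  have hcnt : ∀ i, 1 ≤ i → 2 * i < l → cnt d (i+1) ≤ cnt (lay d w (nb G w)) (i+1) + (if i + 1 ≤ d w then 1 else 0) := by
    intro i hi hi2
    have h1 := cnt_lay (d := d) (w := w) (W := nb G w) (i+1) (by omega)
    rw [filter_false_of_mem] at h1
    · simpa using h1
    · intro v hv hh
      have := hGQ hv
      simp [hQ] at this; omega
  by_cases hnl : cnt d 1 = l
  · apply layoff' ih (by omega) hP hnl hww (hG w) hW1 hw1 hgr
    intro i hi hi2
    have h1 := hcnt i hi (by omega)
    have h2 := hP i hi (by omega)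
    split_ifs at h1 <;> omega
  · apply ConclF.concl
    by_cases hx : Exc l (lay d w (nb G w))
    · exact preExc hx hww (hG w) hw1 hmin (by
        intro v hv; have := hGQ hv; simp [hQ] at this
        have := hx.1; omega)
    refine layoff ih hl hww (hG w) hW1 hw1 hgr ?_ hx
    intro i hi hi2
    have h1 := hcnt i hi (by omega)
    have h2 := hP i hi (by omega)
    split_ifs at h1 with h3
    · have := cnt_min hmin h3
      omega
    · omega

theorem caseOdd {d : V → ℕ} {l m : ℕ} (ih : IHyp V (∑ v, d v)) (hl : 7 ≤ l) (hm : l = 2 * m + 1)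
    (hP : Pos l d) (hg : gr d) {w : V} (hw1 : 1 ≤ d w) (hmin : ∀ v, 1 ≤ d v → d w ≤ d v)
    (hn : cnt d 1 = l) : Concl l d := by
  obtain ⟨G, hG⟩ := hg
  have hgr : gr (lay d w (nb G w)) := ⟨_, layRL hG w⟩
  have hww : w ∉ nb G w := by rw [mem_nb]; exact G.loopless.irrefl w
  have hW1 : ∀ v ∈ nb G w, 1 ≤ d v := fun v hv => adj_supp hG (mem_nb.1 hv).symm
  apply layoff' ih (by omega) hP hn hww (hG w) hW1 hw1 hgr
  intro i hi hi2
  have h1 := cnt_lay' (d := d) (w := w) (W := nb G w) (i+1)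
  have h2 := hP (i+1) (by omega) (by omega)
  split_ifs at h1 with h3
  · have := cnt_min hmin h3
    omega
  · omega

theorem caseC2a {d : V → ℕ} {l m : ℕ} (ih : IHyp V (∑ v, d v)) (hl : 5 ≤ l) (hm : (l - 1) / 2 = m)
    (hP : Pos l d) (hg : gr d) {w : V} (hw1 : 1 ≤ d w) (hmin : ∀ v, 1 ≤ d v → d w ≤ d v)
    (hq : cnt d (m+2) < d w)
    (hn : (l < cnt d 1 ∧ l + 1 - m + (if m + 1 ≤ d w then 1 else 0) + (d w - cnt d (m+2)) ≤ cnt d (m+1)) ∨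
      (6 ≤ l ∧ cnt d 1 = l ∧ l = 2 * m + 2 ∧ l - m + (if m + 1 ≤ d w then 1 else 0) + (d w - cnt d (m+2)) ≤ cnt d (m+1))) :
    (l < cnt d 1 → ConclF l d) ∧ Concl l d := by
  have hev : Even (∑ v, d v) := by obtain ⟨G, hG⟩ := hg; exact hG.even
  have hlt : ∀ v, 1 ≤ d v → d v < cnt d 1 := by obtain ⟨G, hG⟩ := hg; exact fun v hv => deg_lt hG hv
  have hnl := Pos_n hl hP
  have htm : d w ≤ m + 1 := by
    by_contra hc
    have := cnt_min hmin (show m + 2 ≤ d w by omega)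
    have := hlt w hw1
    omega
  set Q := univ.filter (fun v => m + 2 ≤ d v) with hQ
  have hQc : Q.card = cnt d (m+2) := rfl
  set Ex := (univ.filter (fun v => d v = m + 1)).erase w with hEx
  have hp : cnt d (m+1) = cnt d (m+2) + (univ.filter (fun v => d v = m+1)).card := by
    rw [← hQc, ← card_union_of_disjoint]
    · show (univ.filter (fun v => m + 1 ≤ d v)).card = _
      congr 1; ext v; simp [hQ]; omega
    · rw [disjoint_left]; intro v hv hv2; simp [hQ] at hv hv2; omega
  have hExc : cnt d (m+1) = cnt d (m+2) + Ex.card + (if m + 1 ≤ d w then 1 else 0) := by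
    rw [hp, hEx, add_assoc]; congr 1
    by_cases h : d w = m + 1
    · rw [card_erase_of_mem (by simp [h])]
      have : 0 < (univ.filter (fun v => d v = m+1)).card := card_pos.2 ⟨w, by simp [h]⟩
      simp [h]; omega
    · rw [erase_eq_of_notMem (by simp [h])]
      rw [if_neg (by omega)]; rfl
  obtain ⟨E, hE, hEc⟩ := exists_subset_card_eq (show d w - cnt d (m+2) ≤ Ex.card by
    rcases hn with h | h <;> omega)
  have hEd : ∀ v ∈ E, d v = m + 1 ∧ v ≠ w := by
    intro v hv; have := hE hv; simp [hEx] at this; exact ⟨this.2, this.1⟩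
  have hQd : ∀ v, v ∈ Q ↔ m + 2 ≤ d v := by intro v; simp [hQ]
  have hdisj : Disjoint Q E := by
    rw [disjoint_left]; intro v hv hv2
    have := (hQd v).1 hv; have := hEd v hv2; omega
  set W := Q ∪ E with hW
  have hWc : W.card = d w := by rw [hW, card_union_of_disjoint hdisj]; omega
  have hww : w ∉ W := by
    intro h; rcases mem_union.1 h with h | h
    · have := (hQd w).1 h; omega
    · exact (hEd w h).2 rfl
  have hW1 : ∀ v ∈ W, m + 1 ≤ d v := by
    intro v h; rcases mem_union.1 h with h | h
    · have := (hQd v).1 h; omega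
    · have := (hEd v h).1; omega
  have hWf : W.filter (fun v => d v = m + 1) = E := by
    ext v; rw [mem_filter]; constructor
    · rintro ⟨h1, h2⟩
      rcases mem_union.1 h1 with h | h
      · have := (hQd v).1 h; omega
      · exact h
    · intro h; exact ⟨mem_union_right _ h, (hEd v h).1⟩
  set d' := lay d w W with hd'
  have hsum := lay_sum hww hWc (fun v hv => by have := hW1 v hv; omega)
  -- graphic
  have hQsub : Q ⊆ univ.filter (fun v => m + 1 ≤ d' v) := by
    intro v hv
    have h1 := (hQd v).1 hv
    have : v ≠ w := fun e => hww (e ▸ mem_union_left _ hv)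
    have hvW : v ∈ W := mem_union_left _ hv
    simp [hd', lay, this, hvW]; omega
  have hcm := cnt_lay (d := d) (w := w) (W := W) (m+1) (by omega)
  rw [hWf, hEc, ← hd'] at hcm
  obtain ⟨T0, hQT, hT0, hT0c⟩ := exists_subsuperset_card_eq (n := m + 2) hQsub (by omega) (by
    show m + 2 ≤ cnt d' (m+1)
    rcases hn with h | h <;> omega)
  have hT0d : ∀ v ∈ T0, m + 1 ≤ d' v := by intro v hv; have := hT0 hv; simpa using this
  have hd'le : ∀ v, d' v ≤ d v := by intro v; simp only [hd', lay]; split_ifs <;> omega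
  have hd'0 : d' w = 0 := by simp [hd', lay]
  have hgr : gr d' := by
    refine FG (m+1) _ d' ((supp d).erase w) T0 le_rfl ?_ ?_ hT0c ?_ ?_ ?_
    · intro v hv
      by_cases e : v = w
      · rw [e, hd'0]
      · have : ¬ (1 ≤ d v) := fun h => hv (mem_erase.2 ⟨e, mem_supp.2 h⟩)
        have := hd'le v; omega
    · intro v hv
      have h1 := hT0d v hv
      refine mem_erase.2 ⟨?_, mem_supp.2 (by have := hd'le v; omega)⟩
      rintro rfl; omega
    · intro v hv
      have h1 := hT0d v hv
      refine ⟨h1, ?_⟩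
      rw [card_erase_of_mem (mem_supp.2 hw1), supp_card]
      have hvw : v ≠ w := by rintro rfl; omega
      by_cases hvQ : v ∈ Q
      · have hvW : v ∈ W := mem_union_left _ hvQ
        have e : d' v = d v - 1 := by simp [hd', lay, hvw, hvW]
        have := hlt v (by have := hd'le v; omega)
        omega
      · rw [hQd] at hvQ
        have := hd'le v
        omega
    · intro v hv hvT
      rw [mem_erase, mem_supp] at hv
      have hvQ : v ∉ Q := fun h => hvT (hQT h)
      have hvQ' := hvQ
      rw [hQd] at hvQ
      have hle : (T0.filter (fun u => m + 1 < d' u)).card ≤ cnt d (m+2) := by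
        apply card_le_card
        intro x hx
        have := (mem_filter.1 hx).2
        have := hd'le x
        simp; omega
      have h1 := hmin v hv.2
      have h2 := hd'le v
      refine ⟨hle.trans ?_, by omega⟩
      by_cases hvW : v ∈ W
      · have e : d' v = d v - 1 := by simp [hd', lay, hv.1, hvW]
        omega
      · have e : d' v = d v := by simp [hd', lay, hv.1, hvW]
        omega
    · rw [hsum] at hev; exact (Nat.even_add.1 hev).2 (by simp)
  have hcnt : ∀ i, 1 ≤ i → i < m → cnt d (i+1) ≤ cnt d' (i+1) + (if i + 1 ≤ d w then 1 else 0) := by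
    intro i hi hi2
    have h1 := cnt_lay (d := d) (w := w) (W := W) (i+1) (by omega)
    rw [filter_false_of_mem] at h1
    · simpa using h1
    · intro v hv hh
      have := hW1 v hv; omega
  have hW1' : ∀ v ∈ W, 1 ≤ d v := fun v hv => by have := hW1 v hv; omega
  have hbig : l < cnt d 1 → ConclF l d := by
    intro hbig
    refine layoff ih hl hww hWc hW1' hw1 hgr ?_ (by
      rintro ⟨e1, _, e2⟩
      have hm2 : m = 2 := by omega
      obtain ⟨u, hu⟩ := card_pos.1 (show 0 < E.card by omega)
      have h1 := hEd u hu
      have h2 : lay d w W u = d u - 1 := by simp [lay, h1.2, hW, hu]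
      have := e2 u (by omega)
      omega)
    intro i hi hi2; show _ ≤ cnt d' (i+1)
    by_cases him : i = m
    · subst him
      rcases hn with h | h <;> omega
    · have h1 := hcnt i hi (by omega)
      have h2 := hP i hi (by omega)
      split_ifs at h1 with h3
      · have := cnt_min hmin h3
        omega
      · omega
  refine ⟨hbig, ?_⟩
  by_cases hb : l < cnt d 1
  · exact (hbig hb).concl
  rcases hn with h | h
  · omega
  · apply layoff' ih h.1 hP h.2.1 hww hWc hW1' hw1 hgr
    intro i hi hi2; show _ ≤ cnt d' (i+1)
    by_cases him : i = m
    · subst him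
      omega
    · have h1 := hcnt i hi (by omega)
      have h2 := hP i hi (by omega)
      split_ifs at h1 <;> omega

end E
end PT

set_option linter.all false
namespace PT
open Finset
open scoped Classical

section F
variable {V : Type} [Fintype V]

theorem lowest (A : Finset V) (f : V → ℕ) (c : ℕ) (hc : c ≤ A.card) :
    ∃ B ⊆ A, B.card = c ∧ ∀ a ∈ B, ∀ b ∈ A, b ∉ B → f a ≤ f b := by
  induction c with
  | zero => exact ⟨∅, by simp, by simp, by simp⟩
  | succ c ih =>
    obtain ⟨B, hB, hBc, hBf⟩ := ih (by omega)
    have hne : (A \ B).Nonempty := by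
      rw [← card_pos, card_sdiff_of_subset hB]; omega
    obtain ⟨x, hx, hxm⟩ := exists_min_image (A \ B) f hne
    rw [mem_sdiff] at hx
    refine ⟨insert x B, ?_, by rw [card_insert_of_notMem hx.2, hBc], ?_⟩
    · intro z hz; rcases mem_insert.1 hz with rfl | hz
      · exact hx.1
      · exact hB hz
    · intro a ha b hb hbn
      rw [mem_insert, not_or] at hbn
      rcases mem_insert.1 ha with rfl | ha
      · exact hxm b (mem_sdiff.2 ⟨hb, hbn.2⟩)
      · exact hBf a ha b hb hbn.2

theorem image_eq {k : ℕ} {p : ℕ → V} {S : Finset V} (hinj : ∀ i < k, ∀ j < k, p i = p j → i = j)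
    (hS : ∀ i < k, p i ∈ S) (hc : S.card = k) : ∀ x ∈ S, ∃ i < k, p i = x := by
  have : (range k).image p = S := by
    apply eq_of_subset_of_card_le
    · intro x hx
      obtain ⟨i, hi, rfl⟩ := mem_image.1 hx
      exact hS i (mem_range.1 hi)
    · rw [card_image_of_injOn, card_range, hc]
      intro a ha b hb hab
      exact hinj a (by simpa using ha) b (by simpa using hb) hab
  intro x hx
  rw [← this] at hx
  obtain ⟨i, hi, h⟩ := mem_image.1 hx
  exact ⟨i, mem_range.1 hi, h⟩

theorem two_idx {k : ℕ} {p : ℕ → V} {D : Finset V} (hk : 1 ≤ k)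
    (hs : ∀ x ∈ D, ∃ i < k, p i = x) (hD : k + 2 ≤ 2 * D.card) :
    1 < ((range k).filter (fun i => p i ∈ D ∧ p ((i+1)%k) ∈ D)).card := by
  set A := (range k).filter (fun i => p i ∈ D) with hA
  set B := (range k).filter (fun i => p ((i+1)%k) ∈ D) with hB
  have h1 : D.card ≤ A.card := by
    refine (card_le_card (t := A.image p) ?_).trans card_image_le
    intro x hx
    obtain ⟨i, hi, rfl⟩ := hs x hx
    exact mem_image.2 ⟨i, mem_filter.2 ⟨mem_range.2 hi, hx⟩, rfl⟩
  have h2 : D.card ≤ B.card := by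
    refine (card_le_card (t := B.image (fun i => p ((i+1)%k))) ?_).trans card_image_le
    intro x hx
    obtain ⟨i, hi, rfl⟩ := hs x hx
    have e : ((i + k - 1) % k + 1) % k = i := by
      rw [Nat.mod_add_mod, show i + k - 1 + 1 = i + k by omega, Nat.add_mod_right, Nat.mod_eq_of_lt hi]
    refine mem_image.2 ⟨(i + k - 1) % k, mem_filter.2 ⟨mem_range.2 (Nat.mod_lt _ hk), ?_⟩, ?_⟩
    · rw [e]; exact hx
    · rw [e]
  have h3 : (A ∪ B).card ≤ k := by
    have := card_le_card (union_subset (filter_subset _ _) (filter_subset _ _) : A ∪ B ⊆ range k)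
    simpa using this
  have h4 := card_union_add_card_inter A B
  have h5 : A ∩ B = (range k).filter (fun i => p i ∈ D ∧ p ((i+1)%k) ∈ D) := by
    ext i; simp only [hA, hB, mem_inter, mem_filter]; tauto
  rw [h5] at h4
  omega

theorem two_edges {G : SimpleGraph V} {k : ℕ} {p : ℕ → V} {D S : Finset V} (hk : 4 ≤ k) (hp : IsCy G k p)
    (hS : ∀ i < k, p i ∈ S) (hc : S.card = k) (hDS : D ⊆ S) (hD : k + 2 ≤ 2 * D.card) :
    ∃ p', IsCy G k p' ∧ (∀ i < k, p' i ∈ S) ∧ p' (k-1) ∈ D ∧ p' 0 ∈ D ∧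
      ∃ j, j + 2 < k ∧ p' j ∈ D ∧ p' (j+1) ∈ D := by
  have hs := image_eq hp.1 hS hc
  obtain ⟨i1, hi1, _⟩ := one_lt_card.1 (two_idx (by omega) (fun x hx => hs x (hDS hx)) hD)
  rw [mem_filter, mem_range] at hi1
  obtain ⟨p', q1, q2, q3, q4, _⟩ := rot hp (by omega) hi1.1
  have hS' : ∀ i < k, p' i ∈ S := by
    intro i hi; obtain ⟨i', h, e⟩ := q4 i hi; rw [e]; exact hS _ h
  have hs' := image_eq q1.1 hS' hc
  obtain ⟨j, hj, hjk⟩ : ∃ j, (j < k ∧ p' j ∈ D ∧ p' ((j+1)%k) ∈ D) ∧ j ≠ k - 1 := by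
    obtain ⟨a, ha, b, hb, hab⟩ := one_lt_card.1 (two_idx (by omega) (fun x hx => hs' x (hDS hx)) hD)
    rw [mem_filter, mem_range] at ha hb
    by_cases h : a = k - 1
    · exact ⟨b, hb, by omega⟩
    · exact ⟨a, ha, h⟩
  rw [Nat.mod_eq_of_lt (by omega : j + 1 < k)] at hj
  by_cases h : j + 2 < k
  · exact ⟨p', q1, hS', by rw [q3]; exact hi1.2.1, by rw [q2]; exact hi1.2.2, j, h, hj.2⟩
  · refine ⟨_, q1.rev (by omega), fun i hi => hS' _ (by omega), ?_, ?_, 0, by omega, ?_, ?_⟩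
    · simp only [Nat.sub_self]; rw [q2]; exact hi1.2.2
    · simp only [Nat.sub_zero]; rw [q3]; exact hi1.2.1
    · simp only [Nat.sub_zero]; rw [q3]; exact hi1.2.1
    · rw [show k - 1 - (0 + 1) = j by omega]; exact hj.2.1

theorem hub {G : SimpleGraph V} {k : ℕ} {P : ℕ → V} {h : V} (hinj : ∀ i < k, ∀ j < k, P i = P j → i = j)
    (hadj : ∀ i, i + 1 < k → G.Adj (P i) (P (i+1))) (hh : ∀ i < k, G.Adj h (P i)) :
    ∃ S : Finset V, S.card = k + 1 ∧ ∀ r, 3 ≤ r → r ≤ k + 1 → Cyc G S r := by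
  refine ⟨insert h ((range k).image P), ?_, ?_⟩
  · rw [card_insert_of_notMem, card_image_of_injOn, card_range]
    · intro a ha b hb hab
      exact hinj a (by simpa using ha) b (by simpa using hb) hab
    · intro hc
      obtain ⟨i, hi, e⟩ := mem_image.1 hc
      exact (hh i (mem_range.1 hi)).ne e.symm
  · intro r hr hr2
    refine ⟨fun i => if i = 0 then h else P (i-1), ⟨?_, ?_, ?_⟩, ?_⟩
    · intro i hi j hj hij
      simp only at hij
      split_ifs at hij with a b b
      · omega
      · exact absurd hij (hh _ (by omega)).ne
      · exact absurd hij.symm (hh _ (by omega)).ne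
      · have := hinj _ (by omega) _ (by omega) hij
        omega
    · intro i hi
      simp only
      rw [if_neg (by omega : i + 1 ≠ 0), Nat.add_sub_cancel]
      split_ifs with a
      · exact hh _ (by omega)
      · have := hadj (i-1) (by omega)
        rwa [Nat.sub_add_cancel (by omega)] at this
    · simp only [if_true]
      rw [if_neg (by omega)]
      exact (hh _ (by omega)).symm
    · intro i hi
      simp only
      split_ifs
      · exact mem_insert_self _ _
      · exact mem_insert_of_mem (mem_image.2 ⟨_, mem_range.2 (by omega), rfl⟩)

theorem caseDom {d : V → ℕ} {l : ℕ} (ih : IHyp V (∑ v, d v)) (hl : 7 ≤ l)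
    (hP : Pos l d) (hg : gr d) {h : V} (hh1 : 1 ≤ d h) (hh : d h + 1 = cnt d 1) : Concl l d := by
  obtain ⟨G, hG⟩ := hg
  have hN : nb G h = (supp d).erase h := by
    apply eq_of_subset_of_card_le
    · intro u hu
      rw [mem_nb] at hu
      exact mem_erase.2 ⟨hu.ne.symm, mem_supp.2 (adj_supp hG hu.symm)⟩
    · rw [hG, card_erase_of_mem (mem_supp.2 hh1), supp_card]; omega
  set W := (supp d).erase h with hW
  have hww : h ∉ W := by simp [hW]
  have hWc : W.card = d h := by rw [← hN, hG]
  have hW1 : ∀ v ∈ W, 1 ≤ d v := fun v hv => mem_supp.1 (mem_erase.1 hv).2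
  set d' := lay d h W with hd'
  have hgr : gr d' := ⟨_, by have := layRL hG h; rwa [hN] at this⟩
  have hsum := lay_sum hww hWc hW1
  rw [← hd'] at hsum
  have hPk : Pos (l-2) d' := by
    intro i hi hi2
    have h1 := cnt_lay' (d := d) (w := h) (W := W) (i+1)
    have h2 := hP (i+1) (by omega) (by omega)
    rw [← hd'] at h1
    split_ifs at h1 <;> omega
  -- path on l - 1 vertices
  have hpath : ∃ (F' : SimpleGraph V) (P : ℕ → V), RL F' d' ∧ (∀ i < l - 1, ∀ j < l - 1, P i = P j → i = j) ∧
      ∀ i, i + 1 < l - 1 → F'.Adj (P i) (P (i+1)) := by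
    by_cases hx : Exc (l-2) d'
    · obtain ⟨e1, e8, e3⟩ := hx
      obtain ⟨G8, S8, r1, _, a8, b8, _, r2⟩ := explicit (d := d') (L := (supp d').toList) (nodup_toList _)
        (by intro v hv; rw [mem_toList, mem_supp]; exact hv) (map_const (fun v hv => e3 v (mem_supp.1 hv)) e8) (l := 8)
        (E := [(0,5),(0,7),(1,4),(1,7),(2,3),(2,5),(2,6),(3,4),(3,5),(4,6),(6,7)]) (a := 0) (b := 1)
        (C := [[2,3,5],[1,4,6,7],[0,5,2,6,7],[0,5,3,4,1,7],[0,5,2,3,4,1,7],[0,5,3,2,6,4,1,7]])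
        (T := [0,1,2,3,4,5,6,7]) (by decide)
      obtain ⟨P, hP8, _⟩ := r2 8 (by omega) le_rfl
      exact ⟨G8, P, r1, fun i hi j hj hij => hP8.1 i (by omega) j (by omega) hij,
        fun i hi => (hP8.2.1 i (by omega)).1⟩
    obtain ⟨F, S, f1, f2, f3⟩ := ih (l-2) d' (by omega) (by omega) hPk hgr hx
    obtain ⟨p, hp, hpS⟩ := f3 (l-2) (by omega) le_rfl
    obtain ⟨y, hyS, hy1⟩ : ∃ y, y ∉ S ∧ 1 ≤ d' y := by
      by_contra hc; push Not at hc
      have : univ.filter (fun v => 1 ≤ d' v) ⊆ S := by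
        intro v hv
        by_contra hvS
        have := hc v hvS
        simp at hv; omega
      have h1 := card_le_card this
      have h2 := cnt_lay' (d := d) (w := h) (W := W) 1
      have h3 := hP 1 (by omega) (by omega)
      have h4 : cnt d' 1 ≤ S.card := h1
      rw [← hd'] at h2
      split_ifs at h2 <;> omega
    have mk : ∀ (F' : SimpleGraph V) (p : ℕ → V) (y : V), RL F' d' → (∀ i < l-2, ∀ j < l-2, p i = p j → i = j) →
        (∀ i, i + 1 < l-2 → F'.Adj (p i) (p (i+1))) → (∀ i < l-2, p i ≠ y) → F'.Adj (p (l-2-1)) y →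
        ∃ (F' : SimpleGraph V) (P : ℕ → V), RL F' d' ∧ (∀ i < l - 1, ∀ j < l - 1, P i = P j → i = j) ∧
        ∀ i, i + 1 < l - 1 → F'.Adj (P i) (P (i+1)) := by
      intro F' p y g1 g2 g3 g4 g5
      refine ⟨F', fun i => if i < l - 2 then p i else y, g1, ?_, ?_⟩
      · intro i hi j hj hij
        simp only at hij
        split_ifs at hij with a b b
        · exact g2 _ a _ b hij
        · exact absurd hij (g4 _ a)
        · exact absurd hij.symm (g4 _ b)
        · omega
      · intro i hi
        simp only
        rw [if_pos (by omega : i < l - 2)]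
        split_ifs with a
        · exact g3 i a
        · rw [show i = l - 2 - 1 by omega]; exact g5
    by_cases hA : ∃ y b, y ∉ S ∧ b ∈ S ∧ F.Adj y b
    · obtain ⟨y, b, hy, hb, hyb⟩ := hA
      obtain ⟨j, hj, rfl⟩ := image_eq hp.1 hpS f2 b hb
      obtain ⟨p', q1, q2, q3, q4, _⟩ := rot hp (by omega) hj
      refine mk F p' y f1 q1.1 q1.2.1 ?_ ?_
      · intro i hi e
        obtain ⟨i', hi', e'⟩ := q4 i hi
        exact hy (e ▸ e' ▸ hpS i' hi')
      · rw [q3]; exact hyb.symm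
    · push Not at hA
      obtain ⟨b, hb⟩ := card_pos.1 (by rw [f1 y]; omega : 0 < (nb F y).card)
      rw [mem_nb] at hb
      have hbS : b ∉ S := fun hbS => hA y b hyS hbS hb
      have hcS := hpS (l-2-1) (by omega)
      have h0S := hpS 0 (by omega)
      have hsw := switch f1 hb hp.2.2 (hA y _ hyS hcS) (hA b _ hbS h0S)
        (fun e => hyS (e ▸ hcS)) (fun e => hbS (e ▸ h0S))
      refine mk _ p y hsw hp.1 ?_ ?_ ?_
      · intro i hi
        refine Or.inl (Or.inl ⟨⟨hp.2.1 i hi, ?_⟩, ?_⟩)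
        · rintro (⟨e, _⟩ | ⟨_, e⟩)
          · exact hyS (e ▸ hpS i (by omega))
          · exact hyS (e ▸ hpS (i+1) (by omega))
        · rintro (⟨e, _⟩ | ⟨e, e2⟩)
          · have := hp.1 _ (by omega) _ (by omega) e
            omega
          · have := hp.1 _ (by omega) _ (by omega) e
            have := hp.1 _ (by omega) _ (by omega) e2
            omega
      · intro i hi e
        exact hyS (e ▸ hpS i hi)
      · exact Or.inl (Or.inr ⟨fun e => hyS (e ▸ hcS), Or.inr ⟨rfl, rfl⟩⟩)
  obtain ⟨F', P, k1, k2, k3⟩ := hpath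
  have hPd : ∀ i < l - 1, P i ∈ W := by
    intro i hi
    have h1 : 1 ≤ d' (P i) := by
      by_cases c : i + 1 < l - 1
      · exact adj_supp k1 (k3 i c)
      · have := k3 (i-1) (by omega)
        rw [Nat.sub_add_cancel (by omega)] at this
        exact adj_supp k1 this.symm
    have h2 : P i ≠ h := by intro e; rw [e] at h1; simp [hd', lay] at h1
    refine mem_erase.2 ⟨h2, mem_supp.2 (h1.trans ?_)⟩
    simp only [hd', lay]; split_ifs <;> omega
  obtain ⟨S', s1, s2⟩ := hub (G := star F' h W) (k := l - 1) (P := P) (h := h) k2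
    (fun i hi => Or.inl (k3 i hi))
    (fun i hi => Or.inr ⟨fun e => hww (e ▸ hPd i hi), Or.inl ⟨rfl, hPd i hi⟩⟩)
  exact ⟨_, S', star_RL hww hWc hW1 k1, by omega, fun r hr hr2 => s2 r hr (by omega)⟩

end F
end PT

set_option linter.all false
namespace PT
open Finset
open scoped Classical

section G
variable {V : Type} [Fintype V]

theorem endgame {d e : V → ℕ} {k : ℕ} (hk : 4 ≤ k) {x y : V} {D L S : Finset V} (hxy : x ≠ y)
    (hxD : x ∉ D) (hyD : y ∉ D) (hxL : x ∉ L) (hyL : y ∉ L) (hDL : Disjoint D L)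
    (hD : k + 2 ≤ 2 * D.card)
    (hback : ∀ v, e v + (if v ∈ D then 1 else 0) + (if v ∈ L then 1 else 0) + (if v = x then D.card else 0)
      + (if v = y then L.card + 2 else 0) = d v) (hex : e x = 0) (hey : e y = 0)
    {F : SimpleGraph V} (hF : RL F e) (hS : S.card = k) (hc : ∀ r, 3 ≤ r → r ≤ k → Cyc F S r)
    (hDS : D ⊆ S) : Concl (k+2) d := by
  obtain ⟨p0, hp0, hpS0⟩ := hc k (by omega) le_rfl
  obtain ⟨p, hp, hpS, pg, pg', j, hj, pj, pj'⟩ := two_edges hk hp0 hpS0 hS hDS hD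
  have hSe : ∀ v ∈ S, 1 ≤ e v := by
    intro v hv
    obtain ⟨i, hi, rfl⟩ := image_eq hp.1 hpS hS v hv
    obtain ⟨u, hu⟩ := Cyc.pos (G := F) (S := S) (by omega) hp hi
    exact adj_supp hF hu
  have hxS : x ∉ S := fun h => by have := hSe x h; omega
  have hyS : y ∉ S := fun h => by have := hSe y h; omega
  set g := p (k-1) with hg
  have hgL : g ∉ L := disjoint_left.1 hDL pg
  have hgx : g ≠ x := fun h => hxD (h ▸ pg)
  have hgy : g ≠ y := fun h => hyD (h ▸ pg)
  have a1 := RL_star hF (w := x) (W := D.erase g) (fun h => hxD (mem_erase.1 h).2) (fun u _ => noadj hF hex u)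
  set G1 := star F x (D.erase g) with hG1
  set W := insert x (insert g L) with hW
  have hyW : y ∉ W := by simp [hW, hyL, hxy.symm, hgy.symm]
  have hWc : W.card = L.card + 2 := by
    rw [hW, card_insert_of_notMem, card_insert_of_notMem hgL]
    simp [hgx.symm, hxL]
  have a2 := RL_star a1 (w := y) (W := W) hyW (by
    intro u _ hu
    rcases hu with hu | ⟨_, ⟨h, _⟩ | ⟨_, h⟩⟩
    · exact noadj hF hey _ hu
    · exact hxy h.symm
    · exact hyD (mem_erase.1 h).2)
  have hRL : RL (star G1 y W) d := by
    refine a2.congr ?_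
    intro v
    rw [← hback v, hWc, card_erase_of_mem pg]
    have hpos : 0 < D.card := card_pos.2 ⟨g, pg⟩
    by_cases c1 : v = x
    · subst c1; simp [hxD, hxL, hxy, hW]; omega
    by_cases c2 : v = y
    · subst c2; simp [hyD, hyL, hxy.symm, hyW]
    by_cases c3 : v = g
    · simp [c3, pg, hgL, hgx, hgy, hW]
    · have : (v ∈ W) = (v ∈ L) := by simp [hW, c1, c3]
      simp [c1, c2, c3, this]
  set H := star G1 y W with hH
  have hFH : ∀ u v, F.Adj u v → H.Adj u v := fun u v h => Or.inl (Or.inl h)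
  have hxa : ∀ u ∈ D, u ≠ g → H.Adj x u := fun u hu hne =>
    Or.inl (Or.inr ⟨fun h => hxD (h ▸ hu), Or.inl ⟨rfl, mem_erase.2 ⟨hne, hu⟩⟩⟩)
  have hyx : H.Adj y x := Or.inr ⟨hxy.symm, Or.inl ⟨rfl, by simp [hW]⟩⟩
  have hyg : H.Adj y g := Or.inr ⟨hgy.symm, Or.inl ⟨rfl, by simp [hW]⟩⟩
  have hneg : ∀ i, i + 1 < k → p i ≠ g := by
    intro i hi h
    have := hp.1 _ (by omega) _ (by omega) h
    omega
  have hpx : ∀ i < k, p i ≠ x := fun i hi h => hxS (h ▸ hpS i hi)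
  have hpy : ∀ i < k, p i ≠ y := fun i hi h => hyS (h ▸ hpS i hi)
  refine ⟨H, insert x (insert y S), hRL, ?_, ?_⟩
  · rw [card_insert_of_notMem, card_insert_of_notMem hyS, hS]
    simp [hxy, hxS]
  intro r hr hr2
  by_cases c1 : r ≤ k
  · refine (hc r hr c1).mono (fun u _ v _ h => hFH u v h) ?_ (by omega)
    intro z hz; simp [hz]
  by_cases c2 : r = k + 1
  · subst c2
    refine ⟨fun i => if i ≤ j then p i else if i = j + 1 then x else p (i-1), ⟨?_, ?_, ?_⟩, ?_⟩
    · intro a ha b hb hab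
      simp only at hab
      split_ifs at hab
      · exact hp.1 _ (by omega) _ (by omega) hab
      · exact absurd hab (hpx _ (by omega))
      · have := hp.1 _ (by omega) _ (by omega) hab; omega
      · exact absurd hab.symm (hpx _ (by omega))
      · omega
      · exact absurd hab.symm (hpx _ (by omega))
      · have := hp.1 _ (by omega) _ (by omega) hab; omega
      · exact absurd hab (hpx _ (by omega))
      · have := hp.1 _ (by omega) _ (by omega) hab; omega
    · intro i hi
      simp only
      by_cases b1 : i + 1 ≤ j
      · rw [if_pos b1, if_pos (by omega)]
        exact hFH _ _ (hp.2.1 i (by omega))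
      · rw [if_neg b1]
        by_cases b2 : i = j
        · rw [if_pos (by omega), if_pos (by omega), b2]
          exact (hxa _ pj (hneg _ (by omega))).symm
        · rw [if_neg (by omega), if_neg (by omega : ¬ i + 1 = j + 1), Nat.add_sub_cancel]
          by_cases b3 : i = j + 1
          · rw [if_pos b3, b3]
            exact hxa _ pj' (hneg _ (by omega))
          · rw [if_neg b3]
            have := hp.2.1 (i-1) (by omega)
            rw [Nat.sub_add_cancel (by omega)] at this
            exact hFH _ _ this
    · simp only
      rw [if_neg (by omega), if_neg (by omega), if_pos (by omega)]
      exact hFH _ _ hp.2.2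
    · intro i hi
      simp only
      split_ifs
      · simp [hpS i (by omega)]
      · simp
      · simp [hpS (i-1) (by omega)]
  · have : r = k + 2 := by omega
    subst this
    refine ⟨fun i => if i < k then p i else if i = k then y else x, ⟨?_, ?_, ?_⟩, ?_⟩
    · intro a ha b hb hab
      simp only at hab
      split_ifs at hab
      · exact hp.1 _ (by omega) _ (by omega) hab
      · exact absurd hab (hpy _ (by omega))
      · exact absurd hab (hpx _ (by omega))
      · exact absurd hab.symm (hpy _ (by omega))
      · omega
      · exact absurd hab.symm hxy
      · exact absurd hab.symm (hpx _ (by omega))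
      · exact absurd hab hxy
      · omega
    · intro i hi
      simp only
      by_cases b1 : i + 1 < k
      · rw [if_pos b1, if_pos (by omega)]
        exact hFH _ _ (hp.2.1 i b1)
      · rw [if_neg b1]
        by_cases b2 : i < k
        · rw [if_pos b2, if_pos (by omega), show i = k - 1 by omega]
          exact hyg.symm
        · rw [if_neg b2, if_pos (by omega), if_neg (by omega)]
          exact hyx
    · simp only
      rw [if_neg (by omega), if_neg (by omega), if_pos (by omega)]
      exact hxa _ pg' (hneg 0 (by omega))
    · intro i hi
      simp only
      split_ifs with b1
      · simp [hpS i b1]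
      · simp
      · simp

set_option maxHeartbeats 2000000 in
theorem caseMain {d : V → ℕ} {l m : ℕ} (ih : IHyp V (∑ v, d v)) (hl : 7 ≤ l) (hm : (l - 1) / 2 = m)
    (hP : Pos l d) (hg : gr d) {w : V} (hw1 : 1 ≤ d w) (hmin : ∀ v, 1 ≤ d v → d w ≤ d v)
    (hq : cnt d (m+2) < d w) (hn : 2 * m + 2 ≤ cnt d 1) (hnd : ∀ v, d v + 2 ≤ cnt d 1)
    (hp : cnt d (m+1) + cnt d (m+2) + m ≤ l + (if m + 1 ≤ d w then 1 else 0) + d w) : Concl l d := by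
  have hev : Even (∑ v, d v) := by obtain ⟨G, hG⟩ := hg; exact hG.even
  have hnl := Pos_n (by omega) hP
  have hcm := hP m (by omega) (by omega)
  have hc2 : l ≤ cnt d 2 := by have := hP 1 (by omega) (by omega); simpa using this
  have htm : d w ≤ m + 1 := by
    by_contra hc
    have := cnt_min hmin (show m + 2 ≤ d w by omega)
    have := hnd w
    omega
  set Q := univ.filter (fun v => m + 2 ≤ d v) with hQ
  have hQd : ∀ v, v ∈ Q ↔ m + 2 ≤ d v := by intro v; simp [hQ]
  have hQc : Q.card = cnt d (m+2) := rfl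
  set T := univ.filter (fun v => m + 1 ≤ d v) with hT
  have hTd : ∀ v, v ∈ T ↔ m + 1 ≤ d v := by intro v; simp [hT]
  have hTc : T.card = cnt d (m+1) := rfl
  set Z := univ.filter (fun v => 2 ≤ d v) with hZ
  have hZd : ∀ v, v ∈ Z ↔ 2 ≤ d v := by intro v; simp [hZ]
  have hZc : Z.card = cnt d 2 := rfl
  obtain ⟨y, hyZ, hymin⟩ := exists_min_image Z d (card_pos.1 (by omega))
  rw [hZd] at hyZ
  have hymin' : ∀ v, 2 ≤ d v → d y ≤ d v := fun v hv => hymin v ((hZd v).2 hv)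
  have hwy : d w ≤ d y := hmin y (by omega)
  have hyw : 2 ≤ d w → d y = d w := fun h => le_antisymm (hymin' w h) hwy
  have hyt : ∀ j, j ≤ d y → cnt d 2 ≤ cnt d j := by
    intro j hj; apply card_le_card; intro v hv; simp at *; exact hj.trans (hymin' v hv)
  have hym : d y ≤ m + 1 := by
    by_contra hc
    have := hyt (m+2) (by omega)
    omega
  -- top y
  have hyT : m + 1 ≤ d y → d w = m + 1 ∧ cnt d (m+1) = cnt d 1 := by
    intro h
    have h1 := hyt (m+1) h
    have h2 : d w = m + 1 := by
      by_contra hne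
      have : d w ≠ d y := by omega
      have : ¬ (2 ≤ d w) := fun h => this (hyw h).symm
      rw [if_neg (by omega)] at hp
      omega
    refine ⟨h2, le_antisymm (cnt_anti d (by omega)) ?_⟩
    rw [← h2]; exact cnt_min hmin le_rfl
  obtain ⟨x, hxm, hxy⟩ : ∃ x, d x = m + 1 ∧ x ≠ y := by
    by_contra hc; push Not at hc
    have h1 : T ⊆ insert y Q := by
      intro v hv
      rw [hTd] at hv
      rw [mem_insert, hQd]
      by_cases h : d v = m + 1
      · exact Or.inl (hc v h)
      · exact Or.inr (by omega)
    have h2 := (card_le_card h1).trans (card_insert_le _ _)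
    omega
  set R0 := (T.erase x).erase y with hR0
  have hxT : x ∈ T := (hTd x).2 (by omega)
  have hR0c : R0.card + 1 + (if m + 1 ≤ d y then 1 else 0) = cnt d (m+1) := by
    rw [← hTc]
    have hpos : 0 < T.card := card_pos.2 ⟨x, hxT⟩
    by_cases h : m + 1 ≤ d y
    · rw [hR0, card_erase_of_mem (mem_erase.2 ⟨hxy.symm, (hTd y).2 h⟩), card_erase_of_mem hxT, if_pos h]
      have := card_le_card (show {x, y} ⊆ T by intro z hz; simp at hz; rcases hz with rfl | rfl; exact hxT; exact (hTd _).2 h)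
      rw [card_pair hxy] at this
      omega
    · rw [hR0, erase_eq_of_notMem (fun hh => h ((hTd y).1 (mem_erase.1 hh).2)), card_erase_of_mem hxT, if_neg h]
      omega
  have hQR : Q ⊆ R0 := by
    intro v hv
    rw [hQd] at hv
    refine mem_erase.2 ⟨?_, mem_erase.2 ⟨?_, (hTd v).2 (by omega)⟩⟩ <;> rintro rfl <;> omega
  obtain ⟨D, hQD, hDR, hDc⟩ := exists_subsuperset_card_eq (n := m + 1) hQR (by omega) (by
    by_cases h : m + 1 ≤ d y
    · have := hyT h
      rw [if_pos h] at hR0c; omega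
    · rw [if_neg h] at hR0c; omega)
  have hR0d : ∀ v ∈ R0, v ≠ x ∧ v ≠ y ∧ m + 1 ≤ d v := by
    intro v hv; rw [hR0, mem_erase, mem_erase, hTd] at hv; exact ⟨hv.2.1, hv.1, hv.2.2⟩
  have hxD : x ∉ D := fun h => (hR0d x (hDR h)).1 rfl
  have hyD : y ∉ D := fun h => (hR0d y (hDR h)).2.1 rfl
  have hDd : ∀ v ∈ D, m + 1 ≤ d v := fun v hv => (hR0d v (hDR hv)).2.2
  set A := ((Z.erase x).erase y) \ D with hA
  have hAd : ∀ v, v ∈ A ↔ v ≠ x ∧ v ≠ y ∧ 2 ≤ d v ∧ v ∉ D := by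
    intro v; rw [hA, mem_sdiff, mem_erase, mem_erase, hZd]; tauto
  have hDZ : D ⊆ (Z.erase x).erase y := by
    intro v hv
    obtain ⟨h1, h2, h3⟩ := hR0d v (hDR hv)
    exact mem_erase.2 ⟨h2, mem_erase.2 ⟨h1, (hZd v).2 (by omega)⟩⟩
  have hZxy : ((Z.erase x).erase y).card = cnt d 2 - 2 := by
    rw [card_erase_of_mem (mem_erase.2 ⟨hxy.symm, (hZd y).2 hyZ⟩), card_erase_of_mem ((hZd x).2 (by omega)), hZc]
    omega
  have hAc : A.card = cnt d 2 - 2 - (m + 1) := by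
    rw [hA, card_sdiff_of_subset hDZ, hZxy, hDc]
  obtain ⟨L, hLA, hLc, hLf⟩ := lowest A (fun v => if m + 1 ≤ d v then 0 else d v) (d y - 2) (by
    by_cases h : m + 1 ≤ d y
    · have h1 := hyT h
      have h2 := hyt (m+1) h
      have h3 := cnt_anti d (show 1 ≤ 2 by omega)
      have h4 := cnt_anti d (show 2 ≤ m + 1 by omega)
      omega
    · omega)
  have hLd : ∀ v ∈ L, v ≠ x ∧ v ≠ y ∧ 2 ≤ d v ∧ v ∉ D := fun v hv => (hAd v).1 (hLA hv)
  have hxL : x ∉ L := fun h => (hLd x h).1 rfl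
  have hyL : y ∉ L := fun h => (hLd y h).2.1 rfl
  have hDL : Disjoint D L := by rw [disjoint_right]; intro v hv; exact (hLd v hv).2.2.2
  set U := (R0 \ D) \ L with hU
  have hUd : ∀ v ∈ U, v ≠ x ∧ v ≠ y ∧ d v = m + 1 ∧ v ∉ D ∧ v ∉ L := by
    intro v hv
    rw [hU, mem_sdiff, mem_sdiff] at hv
    obtain ⟨⟨h1, h2⟩, h3⟩ := hv
    obtain ⟨g1, g2, g3⟩ := hR0d v h1
    refine ⟨g1, g2, ?_, h2, h3⟩
    have : v ∉ Q := fun h => h2 (hQD h)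
    rw [hQd] at this; omega
  -- if U nonempty then L consists of tops
  have hUL : ∀ a ∈ L, d a ≤ m → U = ∅ := by
    intro a ha ham
    rw [eq_empty_iff_forall_notMem]
    intro b hb
    obtain ⟨g1, g2, g3, g4, g5⟩ := hUd b hb
    have := hLf a ha b ((hAd b).2 ⟨g1, g2, by omega, g4⟩) g5
    rw [if_neg (by omega), if_pos (by omega)] at this
    have := (hLd a ha).2.2.1
    omega
  have hUc : U ≠ ∅ → U.card + (d y - 2) + (m + 1) = R0.card := by
    intro hne
    have hLR : L ⊆ R0 \ D := by
      intro a ha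
      obtain ⟨g1, g2, g3, g4⟩ := hLd a ha
      have : ¬ d a ≤ m := fun h => hne (hUL a ha h)
      exact mem_sdiff.2 ⟨mem_erase.2 ⟨g2, mem_erase.2 ⟨g1, (hTd a).2 (by omega)⟩⟩, g4⟩
    have h1 := card_sdiff_add_card_eq_card hLR
    have h2 := card_sdiff_add_card_eq_card hDR
    rw [← hU] at h1
    omega
  have hUq1 : U.card + cnt d (m+2) ≤ d w := by
    by_cases hne : U = ∅
    · rw [hne]; simp; omega
    · have h1 := hUc hne
      by_cases h2 : 2 ≤ d w
      · have h3 := hyw h2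
        rw [h3] at hR0c h1
        omega
      · rw [if_neg (by omega)] at hp
        omega
  have hUq2 : U.card ≤ l - 2 * m := by
    by_cases hne : U = ∅
    · rw [hne]; simp
    · have h1 := hUc hne
      by_cases h2 : 2 ≤ d w
      · have h3 := hyw h2
        rw [h3] at hR0c h1
        omega
      · rw [if_neg (by omega)] at hp
        omega
  have hUq3 : U.card + cnt d (m+2) ≤ m := by
    by_cases hne : U = ∅
    · rw [hne]; simp; omega
    · have h1 := hUc hne
      by_cases h2 : 2 ≤ d w
      · have h3 := hyw h2
        rw [h3] at hR0c h1
        omega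
      · omega
  -- reduced sequence
  set e : V → ℕ := fun v => if v = x then 0 else if v = y then 0 else
    d v - (if v ∈ D then 1 else 0) - (if v ∈ L then 1 else 0) with he
  have hex : e x = 0 := by simp [he]
  have hey : e y = 0 := by simp [he]
  have heD : ∀ v ∈ D, e v + 1 = d v := by
    intro v hv
    obtain ⟨g1, g2, g3⟩ := hR0d v (hDR hv)
    have g4 : v ∉ L := disjoint_left.1 hDL hv
    simp [he, g1, g2, hv, g4]; omega
  have heL : ∀ v ∈ L, e v + 1 = d v := by
    intro v hv
    obtain ⟨g1, g2, g3, g4⟩ := hLd v hv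
    simp [he, g1, g2, hv, g4]; omega
  have heO : ∀ v, v ≠ x → v ≠ y → v ∉ D → v ∉ L → e v = d v := by
    intro v g1 g2 g3 g4; simp [he, g1, g2, g3, g4]
  have hele : ∀ v, e v ≤ d v := by intro v; simp only [he]; split_ifs <;> omega
  have hback : ∀ v, e v + (if v ∈ D then 1 else 0) + (if v ∈ L then 1 else 0) + (if v = x then D.card else 0)
      + (if v = y then L.card + 2 else 0) = d v := by
    intro v
    by_cases c1 : v = x
    · subst c1; simp [hex, hxD, hxL, hxy]; omega
    by_cases c2 : v = y
    · subst c2; simp [hey, hyD, hyL, hxy.symm]; omega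
    by_cases c3 : v ∈ D
    · have g4 : v ∉ L := disjoint_left.1 hDL c3
      simp [c1, c2, c3, g4]; exact heD v c3
    by_cases c4 : v ∈ L
    · simp [c1, c2, c3, c4]; exact heL v c4
    · simp [c1, c2, c3, c4]; exact heO v c1 c2 c3 c4
  have hsum : ∑ v, d v = ∑ v, e v + 2 * (D.card + L.card + 1) := by
    rw [← sum_congr rfl (fun v _ => hback v)]
    simp only [sum_add_distrib]
    simp; omega
  have htop : ∀ v ∈ R0, m ≤ e v := by
    intro v hv
    obtain ⟨g1, g2, g3⟩ := hR0d v hv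
    by_cases c3 : v ∈ D
    · have := heD v c3; omega
    by_cases c4 : v ∈ L
    · have := heL v c4; omega
    · rw [heO v g1 g2 c3 c4]; omega
  -- Pos
  have hPk : Pos (l-2) e := by
    intro i hi hi2
    by_cases hLi : ∃ a ∈ L, d a = i + 1
    · obtain ⟨a, ha, hai⟩ := hLi
      have hsub : ((Z.erase x).erase y) \ L ⊆ univ.filter (fun v => i + 1 ≤ e v) := by
        intro v hv
        rw [mem_sdiff, mem_erase, mem_erase, hZd] at hv
        obtain ⟨⟨g1, g2, g3⟩, g4⟩ := hv
        simp only [mem_filter, mem_univ, true_and]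
        by_cases c : v ∈ D
        · have := heD v c; have := hDd v c; omega
        · rw [heO v g2 g1 c g4]
          have := hLf a ha v ((hAd v).2 ⟨g2, g1, g3, c⟩) g4
          rw [if_neg (by omega)] at this
          split_ifs at this <;> omega
      have h1 := card_le_card hsub
      have hLs : L ⊆ (Z.erase x).erase y := fun v hv => (mem_sdiff.1 (hLA hv)).1
      rw [card_sdiff_of_subset hLs, hZxy] at h1
      have h2 : d y ≤ i + 1 := by rw [← hai]; exact hymin' a (by omega)
      show _ ≤ (univ.filter (fun v => i + 1 ≤ e v)).card
      omega
    · push Not at hLi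
      have hsub : univ.filter (fun v => i + 1 ≤ d v) ⊆ univ.filter (fun v => i + 1 ≤ e v) ∪ {x, y} := by
        intro v hv
        simp only [mem_filter, mem_univ, true_and, mem_union, mem_insert, mem_singleton] at *
        by_cases c1 : v = x
        · simp [c1]
        by_cases c2 : v = y
        · simp [c2]
        left
        by_cases c3 : v ∈ D
        · have := heD v c3; have := hDd v c3; omega
        by_cases c4 : v ∈ L
        · have := heL v c4; have := hLi v c4; omega
        · rw [heO v c1 c2 c3 c4]; exact hv
      have h1 := (card_le_card hsub).trans (card_union_le _ _)
      rw [card_pair hxy] at h1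
      have h2 : l + 1 - i ≤ (univ.filter (fun v => i + 1 ≤ d v)).card := hP i hi (by omega)
      show _ ≤ (univ.filter (fun v => i + 1 ≤ e v)).card
      omega
  -- graphic
  have hgr : gr e := by
    obtain ⟨D', hQD', hD'D, hD'c⟩ := exists_subsuperset_card_eq (n := m + 1 - U.card) hQD (by omega) (by omega)
    have hUD' : Disjoint U D' := by
      rw [disjoint_left]; intro v hv hv2; exact (hUd v hv).2.2.2.1 (hD'D hv2)
    have hX : (((supp d).erase x).erase y).card = cnt d 1 - 2 := by
      rw [card_erase_of_mem (mem_erase.2 ⟨hxy.symm, mem_supp.2 (by omega)⟩), card_erase_of_mem (mem_supp.2 (by omega)), supp_card]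
      omega
    have hT0 : ∀ v ∈ U ∪ D', v ≠ x ∧ v ≠ y ∧ m + 1 ≤ d v := by
      intro v hv
      rcases mem_union.1 hv with hv | hv
      · have := hUd v hv; exact ⟨this.1, this.2.1, by omega⟩
      · exact hR0d v (hDR (hD'D hv))
    refine FG m _ e (((supp d).erase x).erase y) (U ∪ D') le_rfl ?_ ?_ ?_ ?_ ?_ ?_
    · intro v hv
      by_cases c1 : v = x
      · rw [c1, hex]
      by_cases c2 : v = y
      · rw [c2, hey]
      have : ¬ 1 ≤ d v := fun h => hv (mem_erase.2 ⟨c2, mem_erase.2 ⟨c1, mem_supp.2 h⟩⟩)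
      have := hele v
      omega
    · intro v hv
      obtain ⟨g1, g2, g3⟩ := hT0 v hv
      exact mem_erase.2 ⟨g2, mem_erase.2 ⟨g1, mem_supp.2 (by omega)⟩⟩
    · rw [card_union_of_disjoint hUD', hD'c]; omega
    · intro v hv
      obtain ⟨g1, g2, g3⟩ := hT0 v hv
      refine ⟨htop v (mem_erase.2 ⟨g2, mem_erase.2 ⟨g1, (hTd v).2 g3⟩⟩), ?_⟩
      rw [hX]
      rcases mem_union.1 hv with hv | hv
      · have := hUd v hv; have := hele v; omega
      · have := heD v (hD'D hv); have := hnd v; omega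
    · intro v hv hvT
      rw [mem_erase, mem_erase, mem_supp] at hv
      obtain ⟨g2, g1, g3⟩ := hv
      have hle : ((U ∪ D').filter (fun u => m < e u)).card ≤ U.card + cnt d (m+2) := by
        have : (U ∪ D').filter (fun u => m < e u) ⊆ U ∪ Q := by
          intro z hz
          rw [mem_filter, mem_union] at hz
          rcases hz with ⟨hz | hz, h⟩
          · exact mem_union_left _ hz
          · have := heD z (hD'D hz)
            exact mem_union_right _ ((hQd z).2 (by omega))
        exact (card_le_card this).trans (card_union_le _ _)
      have hvU : v ∉ U := fun h => hvT (mem_union_left _ h)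
      have hvQ : ¬ (m + 2 ≤ d v) := fun h => hvT (mem_union_right _ (hQD' ((hQd v).2 h)))
      have hvt := hmin v g3
      by_cases c3 : v ∈ D
      · have := heD v c3; have := hDd v c3; omega
      by_cases c4 : v ∈ L
      · have h1 := heL v c4
        by_cases c5 : d v ≤ m
        · have h2 := hUL v c4 c5
          have h3 : U.card = 0 := by rw [h2]; simp
          omega
        · omega
      · have h1 := heO v g1 g2 c3 c4
        have : ¬ (m + 1 ≤ d v) := by
          intro h
          apply hvU
          exact mem_sdiff.2 ⟨mem_sdiff.2 ⟨mem_erase.2 ⟨g2, mem_erase.2 ⟨g1, (hTd v).2 h⟩⟩, c3⟩, c4⟩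
        omega
    · rw [hsum] at hev; exact (Nat.even_add.1 hev).2 (by simp)
  by_cases hx : Exc (l-2) e
  · obtain ⟨x1, x2, x3⟩ := hx
    have hl8 : l = 8 := by omega
    have hm3 : m = 3 := by omega
    subst hl8
    subst hm3
    have hD4 : ∀ v ∈ D, d v = 4 := by
      intro v hv
      have h1 := heD v hv
      have h2 := hDd v hv
      have := x3 v (by omega)
      omega
    have hL4 : ∀ v ∈ L, d v = 4 := by
      intro v hv
      have h1 := heL v hv
      have h2 := (hLd v hv).2.2.1
      have := x3 v (by omega)
      omega
    have hO3 : ∀ v, v ≠ x → v ≠ y → v ∉ D → v ∉ L → 1 ≤ d v → d v = 3 := by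
      intro v g1 g2 g3 g4 g5
      have h1 := heO v g1 g2 g3 g4
      have := x3 v (by omega)
      omega
    have hse : (supp e).card = 8 := x2
    have hDLs : D ∪ L ⊆ supp e := by
      intro v hv
      rw [mem_supp]
      rcases mem_union.1 hv with hv | hv
      · have := heD v hv; have := hD4 v hv; omega
      · have := heL v hv; have := hL4 v hv; omega
    have hDLc : (D ∪ L).card = 4 + (d y - 2) := by rw [card_union_of_disjoint hDL, hDc, hLc]
    have hsed := card_sdiff_add_card_eq_card hDLs
    have hxDL : x ∉ D ∪ L := by simp [hxD, hxL]
    have hyB : y ∉ supp e \ (D ∪ L) := by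
      intro h; have := mem_supp.1 (mem_sdiff.1 h).1; omega
    have hB3 : ∀ v ∈ supp e \ (D ∪ L), d v = 3 := by
      intro v hv
      rw [mem_sdiff, mem_union, not_or, mem_supp] at hv
      refine hO3 v ?_ ?_ hv.2.1 hv.2.2 (hv.1.trans (hele v))
      · rintro rfl; omega
      · rintro rfl; omega
    have hy3 : d y = 3 := by
      have hy4 : ¬ (3 + 1 ≤ d y) := by
        intro h
        have h1 := hyT h
        obtain ⟨b, hb⟩ := card_pos.1 (show 0 < (supp e \ (D ∪ L)).card by omega)
        have h2 := hB3 b hb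
        have := hmin b (by omega)
        omega
      have hsub : T ⊆ insert x (D ∪ L) := by
        intro v hv
        rw [hTd] at hv
        by_contra hc
        rw [mem_insert, mem_union, not_or, not_or] at hc
        have : v ≠ y := by rintro rfl; omega
        have := hO3 v hc.1 this hc.2.1 hc.2.2 (by omega)
        omega
      have h1 := (card_le_card hsub).trans (card_insert_le _ _)
      omega
    have hAc6 : (insert x (D ∪ L)).card = 6 := by rw [card_insert_of_notMem hxDL]; omega
    have hBc4 : (insert y (supp e \ (D ∪ L))).card = 4 := by rw [card_insert_of_notMem hyB]; omega
    have hA4 : ∀ v ∈ insert x (D ∪ L), d v = 4 := by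
      intro v hv
      rw [mem_insert, mem_union] at hv
      rcases hv with rfl | hv | hv
      · omega
      · exact hD4 v hv
      · exact hL4 v hv
    have hB3' : ∀ v ∈ insert y (supp e \ (D ∪ L)), d v = 3 := by
      intro v hv
      rw [mem_insert] at hv
      rcases hv with rfl | hv
      · exact hy3
      · exact hB3 v hv
    refine (explicitF (d := d) (L := (insert x (D ∪ L)).toList ++ (insert y (supp e \ (D ∪ L))).toList) ?_ ?_
      (g := List.replicate 6 4 ++ List.replicate 4 3)
      (by rw [List.map_append, map_const hA4 hAc6, map_const hB3' hBc4]) (l := 8)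
      (E := [(0,3),(0,7),(0,9),(1,4),(1,5),(1,6),(1,8),(2,3),(2,5),(2,6),(3,6),(3,7),(4,7),(4,8),(4,9),(5,8),(5,9)])
      (a := 0) (b := 2) (C := [[0,3,7],[1,5,2,6],[1,5,2,3,6],[0,3,6,1,4,7],[0,3,2,5,1,4,7],[0,3,6,2,5,1,4,7]])
      (T := [0,3,6,2,5,1,4,7]) (by decide) rfl).concl
    · refine List.Nodup.append (nodup_toList _) (nodup_toList _) ?_
      intro v hv hv2
      rw [mem_toList] at hv hv2
      have := hA4 v hv
      have := hB3' v hv2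
      omega
    · intro v hv
      rw [List.mem_append, mem_toList, mem_toList]
      by_cases c1 : v = x
      · simp [c1]
      by_cases c2 : v = y
      · simp [c2]
      by_cases c3 : v ∈ D
      · simp [c3]
      by_cases c4 : v ∈ L
      · simp [c4]
      · right
        have := heO v c1 c2 c3 c4
        rw [mem_insert, mem_sdiff, mem_union, mem_supp]
        right
        exact ⟨by omega, by tauto⟩
  obtain ⟨F0, S0, f1, f2, f3⟩ := ih (l-2) e (by omega) (by omega) hPk hgr hx
  obtain ⟨F, S, k1, k2, k3, k4⟩ := GJL_many D _ F0 S0 f1 f3 le_rfl (by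
    intro S' hS' hDS'
    obtain ⟨u, huD, huS⟩ := not_subset.1 hDS'
    have h1 : (D ∩ S').card ≤ m := by
      have : D ∩ S' ⊆ D.erase u := by
        intro z hz; rw [mem_inter] at hz
        exact mem_erase.2 ⟨fun h => huS (h ▸ hz.2), hz.1⟩
      have := card_le_card this
      rw [card_erase_of_mem huD] at this
      omega
    obtain ⟨s, hs, hsn⟩ : ∃ s ∈ S', s ∉ (D ∩ S') ∪ U := by
      by_contra hc; push Not at hc
      have h2 := (card_le_card (show S' ⊆ (D ∩ S') ∪ U from hc)).trans (card_union_le _ _)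
      omega
    rw [mem_union, mem_inter, not_or] at hsn
    have hsD : s ∉ D := fun h => hsn.1 ⟨h, hs⟩
    refine ⟨s, hs, hsD, ?_⟩
    intro u hu
    have h3 := htop u (hDR hu)
    refine le_trans ?_ h3
    by_cases c1 : s = x
    · rw [c1, hex]; omega
    by_cases c2 : s = y
    · rw [c2, hey]; omega
    have hsQ : ¬ (m + 2 ≤ d s) := fun h => hsD (hQD ((hQd s).2 h))
    by_cases c4 : s ∈ L
    · have := heL s c4; omega
    · rw [heO s c1 c2 hsD c4]
      by_contra h
      exact hsn.2 (mem_sdiff.2 ⟨mem_sdiff.2 ⟨mem_erase.2 ⟨c2, mem_erase.2 ⟨c1, (hTd s).2 (by omega)⟩⟩, hsD⟩, c4⟩))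
  have := endgame (k := l - 2) (by omega) hxy hxD hyD hxL hyL hDL (by omega) hback hex hey k1 (by omega) k2 k4
  rwa [show l - 2 + 2 = l by omega] at this

end G
end PT

set_option linter.all false
namespace PT
open Finset
open scoped Classical

section H
variable {V : Type} [Fintype V]

/-- set the value at `z` to zero -/
noncomputable def zer (d : V → ℕ) (z : V) : V → ℕ := fun v => if v = z then 0 else d v

theorem zer_self (d : V → ℕ) (z : V) : zer d z z = 0 := by simp [zer]
theorem zer_ne {d : V → ℕ} {z v : V} (h : v ≠ z) : zer d z v = d v := by simp [zer, h]
theorem zer_le (d : V → ℕ) (z v : V) : zer d z v ≤ d v := by unfold zer; split_ifs <;> omega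

theorem cnt_zer (d : V → ℕ) (z : V) {j : ℕ} (hj : 1 ≤ j) :
    cnt (zer d z) j + (if j ≤ d z then 1 else 0) = cnt d j := by
  have h : univ.filter (fun v => j ≤ zer d z v) = (univ.filter (fun v => j ≤ d v)).erase z := by
    ext v
    rw [mem_filter, mem_erase, mem_filter]
    unfold zer
    by_cases e : v = z
    · simp [e]; omega
    · simp [e]
  unfold cnt
  rw [h]
  split_ifs with c
  · exact card_erase_add_one (by simp [c])
  · rw [erase_eq_of_notMem (by simp; omega)]; rfl

theorem sum_zer (d : V → ℕ) (z : V) : ∑ v, zer d z v + d z = ∑ v, d v := by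
  have : ∀ v, d v = zer d z v + (if v = z then d z else 0) := by
    intro v; unfold zer; split_ifs with h
    · simp [h]
    · rfl
  rw [sum_congr rfl (fun v _ => this v), sum_add_distrib]
  simp

theorem gr3 {d : V → ℕ} (h4 : cnt d 4 ≤ 4) (h3 : 4 ≤ cnt d 3) (hq : ∀ v, 1 ≤ d v → cnt d 4 ≤ d v)
    (hlt : ∀ v, 1 ≤ d v → d v < cnt d 1) (hev : Even (∑ v, d v)) : gr d := by
  obtain ⟨T, hT1, hT2, hT3⟩ := exists_subsuperset_card_eq (n := 4)
    (show univ.filter (fun v => 4 ≤ d v) ⊆ univ.filter (fun v => 3 ≤ d v) by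
      intro v hv; simp at *; omega) h4 h3
  have hTd : ∀ v ∈ T, 3 ≤ d v := by intro v hv; have := hT2 hv; simpa using this
  refine FG 3 _ d (supp d) T le_rfl ?_ ?_ hT3 ?_ ?_ hev
  · intro v hv; rw [mem_supp] at hv; omega
  · intro v hv; rw [mem_supp]; have := hTd v hv; omega
  · intro v hv
    have := hTd v hv
    exact ⟨this, by rw [supp_card]; exact hlt v (by omega)⟩
  · intro v hv hvT
    rw [mem_supp] at hv
    constructor
    · refine le_trans (card_le_card ?_) (hq v hv)
      intro u hu; simp at *; exact hu.2
    · by_contra hc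
      exact hvT (hT1 (by simp; omega))

theorem Sub {d : V → ℕ} {l : ℕ} {z : V} (hz : d z = 2) (h : ConclF l (zer d z)) : ConclF l d := by
  obtain ⟨G, S, hG, hS, a, b, hab, hC⟩ := h
  have hzn : ∀ u, ¬ G.Adj z u := noadj hG (zer_self d z)
  have hza : z ≠ a := by rintro rfl; exact hzn _ hab
  have hzb : z ≠ b := by rintro rfl; exact hzn _ hab.symm
  have h1 := RL_star (RL_delE hG hab) (w := z) (W := {a, b}) (by simp [hza, hzb]) (fun u _ hu => hzn u hu.1)
  refine ⟨star (delE G a b) z {a, b}, S, h1.congr ?_, hS, z, a, Or.inr ⟨hza, Or.inl ⟨rfl, by simp⟩⟩, ?_⟩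
  · intro v
    have ha1 := adj_supp hG hab
    have hb1 := adj_supp hG hab.symm
    have hne := hab.ne
    rw [card_pair hne]
    by_cases e1 : v = z
    · subst e1; simp [hza, hzb, zer_self, hz]
    · rw [zer_ne e1]
      rw [zer_ne hza.symm] at ha1
      rw [zer_ne hzb.symm] at hb1
      by_cases e2 : v = a
      · subst e2; simp [hne, e1]; omega
      · by_cases e3 : v = b
        · subst e3; simp [e2, e1]; omega
        · simp [e1, e2, e3]
  · intro r hr hr2
    refine (hC r hr hr2).mono ?_ (Subset.refl _) (by omega)
    intro x _ y _ hxy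
    refine ⟨Or.inl hxy, ?_⟩
    rintro (⟨rfl, rfl⟩ | ⟨rfl, rfl⟩)
    · exact hzn _ hxy.1
    · exact hzn _ hxy.1.symm

/-- lower the value at `h` by two -/
noncomputable def low (d : V → ℕ) (h : V) : V → ℕ := fun v => if v = h then d h - 2 else d v

theorem cnt_low {d : V → ℕ} {h : V} {j : ℕ} (hj : j + 2 ≤ d h) : cnt (low d h) j = cnt d j := by
  unfold cnt; congr 1; ext v
  rw [mem_filter, mem_filter]
  unfold low
  split_ifs with e
  · subst e; simp; omega
  · rfl

theorem sum_low {d : V → ℕ} {h : V} (hh : 2 ≤ d h) : ∑ v, low d h v + 2 = ∑ v, d v := by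
  have : ∀ v, d v = low d h v + (if v = h then 2 else 0) := by
    intro v; unfold low; split_ifs with e
    · subst e; omega
    · rfl
  rw [sum_congr rfl (fun v _ => this v), sum_add_distrib]
  simp

theorem Tri {d : V → ℕ} {l : ℕ} {h z z' : V} (hh : 3 ≤ d h) (hz : d z = 2) (hz' : d z' = 2) (hne : z ≠ z')
    (hC : Concl l (zer (zer (low d h) z) z')) : ConclF l d := by
  obtain ⟨G, S, hG, hS, hC⟩ := hC
  have hzh : z ≠ h := by rintro rfl; omega
  have hzh' : z' ≠ h := by rintro rfl; omega
  have hzn : ∀ u, ¬ G.Adj z u := noadj hG (by rw [zer_ne hne, zer_self])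
  have hzn' : ∀ u, ¬ G.Adj z' u := noadj hG (zer_self _ _)
  have h1 := RL_star hG (w := z) (W := {h, z'}) (by simp [hzh, hne]) (fun u _ hu => hzn u hu)
  have h2 := RL_star h1 (w := z') (W := {h}) (by simp [hzh']) (by
    intro u hu
    rw [mem_singleton] at hu
    subst hu
    rintro (hu | ⟨_, ⟨hu, _⟩ | ⟨hu, _⟩⟩)
    · exact hzn' _ hu
    · exact hne hu.symm
    · exact hzh hu.symm)
  refine ⟨_, S, h2.congr ?_, hS, z, z', Or.inl (Or.inr ⟨hne, Or.inl ⟨rfl, by simp⟩⟩), ?_⟩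
  · intro v
    rw [card_pair hzh'.symm]
    by_cases e1 : v = z'
    · subst e1; simp [zer, hne.symm, hzh', hz']
    by_cases e2 : v = z
    · subst e2; simp [zer, hne, hzh, hz]
    by_cases e3 : v = h
    · subst e3; simp [zer, low, e1, e2]; omega
    · simp [zer, low, e1, e2, e3]
  · intro r hr hr2
    refine (hC r hr hr2).mono ?_ (Subset.refl _) (by omega)
    intro x _ y _ hxy
    refine ⟨Or.inl (Or.inl hxy), ?_⟩
    rintro (⟨rfl, rfl⟩ | ⟨rfl, rfl⟩)
    · exact hzn _ hxy
    · exact hzn _ hxy.symm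

theorem pos56 {d : V → ℕ} {l : ℕ} (hl : l ≤ 6) (h2 : l ≤ cnt d 2) (h3 : l ≤ cnt d 3 + 1) : Pos l d := by
  intro i hi hi2
  have : i = 1 ∨ i = 2 := by omega
  rcases this with rfl | rfl
  · simpa using h2
  · show l + 1 - 2 ≤ cnt d 3
    omega

theorem T1 (k : ℕ) : ∀ d : V → ℕ, cnt d 4 = 0 → cnt d 3 = 5 → cnt d 2 = k + 6 → cnt d 1 = k + 7 → ConclF 6 d := by
  induction k with
  | zero =>
    intro d h4 h3 h2 h1
    obtain ⟨Qs, L, q1, q2, q3, q4, q5, q6, q7, q8, q9, q10⟩ := lst d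
    have : Qs = [] := List.length_eq_zero_iff.1 (by omega)
    subst this
    rw [show num d 3 = 5 by omega, show num d 2 = 1 by omega, show num d 1 = 1 by omega, List.map_nil] at q5
    exact explicitF q3 q4 q5 (E := [(0,1),(0,2),(0,3),(1,2),(1,3),(2,4),(3,5),(4,5)]) (a := 4) (b := 6)
      (C := [[0,1,2],[0,2,1,3],[0,2,4,5,3],[0,1,2,4,5,3]]) (T := [0,1,2,4,5,3]) (by decide) rfl
  | succ k ih =>
    intro d h4 h3 h2 h1
    obtain ⟨z, hz⟩ : ∃ z, d z = 2 := by
      by_contra hc; push Not at hc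
      have : cnt d 2 ≤ cnt d 3 := by
        apply card_le_card; intro v hv; simp at *; have := hc v; omega
      omega
    apply Sub hz
    have c4 := cnt_zer d z (j := 4) (by omega)
    have c3 := cnt_zer d z (j := 3) (by omega)
    have c2 := cnt_zer d z (j := 2) (by omega)
    have c1 := cnt_zer d z (j := 1) (by omega)
    rw [hz] at c4 c3 c2 c1
    simp at c4 c3 c2 c1
    exact ih _ (by omega) (by omega) (by omega) (by omega)

/-- minimum degree one, no vertex of degree at least four -/
theorem caseT1 {d : V → ℕ} {l : ℕ} (ih : IHyp V (∑ v, d v)) (hl : l = 5 ∨ l = 6) (hg : gr d)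
    {w : V} (hw : d w = 1) (h4 : cnt d 4 = 0) (h3 : cnt d 3 + 1 = l) (h2 : l ≤ cnt d 2) : Concl l d := by
  have hev : Even (∑ v, d v) := by obtain ⟨G, hG⟩ := hg; exact hG.even
  have hle : ∀ v, d v ≤ 3 := by
    intro v
    by_contra hc
    have : 0 < cnt d 4 := card_pos.2 ⟨v, by simp; omega⟩
    omega
  have c4 := cnt_zer d w (j := 4) (by omega)
  have c3 := cnt_zer d w (j := 3) (by omega)
  have c2 := cnt_zer d w (j := 2) (by omega)
  have s1 := sum_zer d w
  rw [hw] at c4 c3 c2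
  simp at c4 c3 c2
  by_cases hw' : ∃ w', w' ≠ w ∧ d w' = 1
  · obtain ⟨w', hne, hw'⟩ := hw'
    have e4 := cnt_zer (zer d w) w' (j := 4) (by omega)
    have e3 := cnt_zer (zer d w) w' (j := 3) (by omega)
    have e2 := cnt_zer (zer d w) w' (j := 2) (by omega)
    have s2 := sum_zer (zer d w) w'
    rw [zer_ne hne, hw'] at e4 e3 e2 s2
    simp at e4 e3 e2
    have e1 := cnt_anti (zer (zer d w) w') (show 1 ≤ 2 by omega)
    have hgr : gr (zer (zer d w) w') := by
      apply gr3
      · omega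
      · omega
      · intro v hv; omega
      · intro v hv
        have := zer_le (zer d w) w' v
        have := zer_le d w v
        have := hle v
        omega
      · rw [show ∑ v, d v = ∑ v, zer (zer d w) w' v + 2 by omega] at hev
        exact (Nat.even_add.1 hev).2 (by simp)
    obtain ⟨G, S, g1, g2, g3⟩ := ih l (zer (zer d w) w') (by omega) (by omega) (pos56 (by omega) (by omega) (by omega)) hgr (by
      rintro ⟨x1, x2, x3⟩
      have : cnt (zer (zer d w) w') 1 ≤ cnt (zer (zer d w) w') 3 := by
        apply card_le_card; intro v hv; simp at *; rw [x3 v (by omega)]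
      omega)
    refine ⟨addE G w w', S, (RL_addE g1 hne.symm (noadj g1 (by rw [zer_ne hne.symm, zer_self]) _)).congr ?_, g2, ?_⟩
    · intro v
      by_cases a1 : v = w'
      · subst a1; simp [zer, hne, hw']
      by_cases a2 : v = w
      · subst a2; simp [zer, hw, a1]
      · simp [zer, a1, a2]
    · intro r hr hr2
      exact (g3 r hr hr2).mono (fun x _ y _ hxy => Or.inl hxy) (Subset.refl _) (by omega)
  · push Not at hw'
    obtain ⟨Qs, L, q1, q2, q3, q4, q5, q6, q7, q8, q9, q10⟩ := lst d
    have : Qs = [] := List.length_eq_zero_iff.1 (by omega)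
    subst this
    have hn1 : num d 1 = 1 := by
      unfold num
      rw [card_eq_one]
      refine ⟨w, ?_⟩
      ext v
      simp
      constructor
      · intro h; by_contra hc; exact hw' v hc h
      · rintro rfl; exact hw
    simp at q6
    obtain ⟨k, hk⟩ := hev
    have hl6 : l = 6 := by omega
    subst hl6
    have := T1 (cnt d 2 - 6) d h4 (by omega) (by omega) (by omega)
    exact this.concl

end H
end PT

set_option linter.all false
namespace PT
open Finset
open scoped Classical

section I
variable {V : Type} [Fintype V]

theorem T2 (N : ℕ) : ∀ (d : V → ℕ) (l : ℕ), ∑ v, d v ≤ N → IHyp V (∑ v, d v) → (l = 5 ∨ l = 6) →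
    (∀ v, 1 ≤ d v → 2 ≤ d v) → cnt d 4 ≤ 2 → ((∃ v, d v = 2) → cnt d 4 ≤ 1) → (∀ v, 1 ≤ d v → d v < cnt d 1) →
    Even (∑ v, d v) → l ≤ cnt d 1 → l ≤ cnt d 3 + 1 → ¬ Exc l d → ConclF l d := by
  induction N with
  | zero =>
    intro d l hN _ _ _ _ _ _ _ h1 h3 _
    have : cnt d 3 = 0 := by
      unfold cnt; rw [card_eq_zero, filter_eq_empty_iff]
      intro v _ hv
      have := single_le_sum (f := d) (fun _ _ => Nat.zero_le _) (mem_univ v)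
      omega
    omega
  | succ N IH =>
    intro d l hN ih hl hd2 hq hq2 hlt hev hn hp hx
    obtain ⟨Qs, L, q1, q2, q3, q4, q5, q6, q7, q8, q9, q10⟩ := lst d
    have hn1 : num d 1 = 0 := by
      unfold num; rw [card_eq_zero, filter_eq_empty_iff]
      intro v _ hv; have := hd2 v (by omega); omega
    obtain ⟨ev, hev'⟩ := hev
    rw [hev'] at q6
    have hQlt : ∀ v ∈ Qs, 4 ≤ d v ∧ d v < cnt d 1 := by
      intro v hv
      have := (q2 v).1 hv
      exact ⟨this, hlt v (by omega)⟩
    have hcases : Qs = [] ∨ (∃ x, Qs = [x]) ∨ ∃ x y, Qs = [x, y] := by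
      match Qs, q7 with
      | [], _ => simp
      | [x], _ => simp
      | [x, y], _ => simp
      | x :: y :: z :: t, h => simp at h; omega
    by_cases hz : ∃ z, d z = 2
    · obtain ⟨z, hz⟩ := hz
      have hq1 := hq2 ⟨z, hz⟩
      have hn2 : 1 ≤ num d 2 := card_pos.2 ⟨z, by simp [hz]⟩
      have hcases' : Qs = [] ∨ (∃ x, Qs = [x]) := by
        rcases hcases with h | h | ⟨x, y, h⟩
        · exact Or.inl h
        · exact Or.inr h
        · rw [h] at q7; simp at q7; omega
      by_cases hnl : l < cnt d 1
      · by_cases hdom : ∃ h, d h + 1 = cnt d 1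
        · -- dominating vertex
          obtain ⟨h, hh⟩ := hdom
          have hhQ := (q2 h).2 (by omega)
          have hQ : Qs = [h] := by
            rcases hcases' with h' | ⟨x, h'⟩
            · rw [h'] at hhQ; simp at hhQ
            · rw [h'] at hhQ ⊢; simp at hhQ; rw [hhQ]
          subst hQ
          simp at q6 q7
          by_cases hbig : l + 2 ≤ cnt d 1
          · obtain ⟨z', hz', hne⟩ : ∃ z', d z' = 2 ∧ z' ≠ z := by
              have h2 : 1 < num d 2 := by omega
              obtain ⟨z', hz', hne⟩ := exists_mem_ne h2 z
              exact ⟨z', by simpa using hz', hne⟩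
            apply Tri (h := h) (by omega) hz hz' hne.symm
            have hzh : z ≠ h := by rintro rfl; omega
            have hzh' : z' ≠ h := by rintro rfl; omega
            have l1 : low d h z = 2 := by simp [low, hzh, hz]
            have l2 : zer (low d h) z z' = 2 := by simp [zer, low, hzh', hz', hne]
            have s0 := sum_low (d := d) (h := h) (by omega)
            have s1 := sum_zer (low d h) z
            have s2 := sum_zer (zer (low d h) z) z'
            have hcn : ∀ j, 1 ≤ j → j ≤ 4 → cnt (zer (zer (low d h) z) z') j + 2 * (if j ≤ 2 then 1 else 0) = cnt d j := by
              intro j hj hj4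
              have e1 := cnt_low (d := d) (h := h) (j := j) (by omega)
              have e2 := cnt_zer (low d h) z hj
              have e3 := cnt_zer (zer (low d h) z) z' hj
              rw [l1] at e2
              rw [l2] at e3
              split_ifs at * <;> omega
            have k4 := hcn 4 (by omega) (by omega)
            have k3 := hcn 3 (by omega) (by omega)
            have k2 := hcn 2 (by omega) (by omega)
            have k1 := hcn 1 (by omega) (by omega)
            simp at k4 k3 k2 k1
            have hlow : ∀ v, 1 ≤ zer (zer (low d h) z) z' v → (v = h ∧ zer (zer (low d h) z) z' v = d h - 2) ∨
                (v ≠ h ∧ zer (zer (low d h) z) z' v = d v) := by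
              intro v
              unfold zer low
              by_cases e1 : v = z'
              · simp [e1]
              by_cases e2 : v = z
              · simp [e2]
              by_cases e3 : v = h
              · subst e3; simp [e1, e2]
              · simp [e1, e2, e3]
            have hother : ∀ v, v ≠ h → d v ≤ 3 := by
              intro v hv
              by_contra hc
              have := (q2 v).2 (by omega)
              simp at this
              exact hv this
            refine ih l _ (by omega) (by omega) (pos56 (by omega) (by omega) (by omega)) ?_ ?_
            · apply gr3
              · omega
              · omega
              · intro v hv; omega
              · intro v hv
                rcases hlow v hv with ⟨e, e'⟩ | ⟨e, e'⟩
                · omega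
                · have := hother v e
                  omega
              · exact ⟨ev - 3, by omega⟩
            · rintro ⟨x1, x2, x3⟩
              have h5 : zer (zer (low d h) z) z' h = d h - 2 := by
                simp [zer, low, hzh.symm, hzh'.symm]
              have := x3 h (by omega)
              omega
          · have hc1 : cnt d 1 = l + 1 := by omega
            have hn22 : num d 2 = 2 := by omega
            rw [hn1, hn22] at q5
            rcases hl with rfl | rfl
            · rw [show num d 3 = 3 by omega, List.map_cons, List.map_nil, show d h = 5 by omega] at q5
              exact explicitF q3 q4 q5 (E := [(0,2),(0,3),(0,4),(0,5),(1,2),(1,3),(2,4),(3,5)]) (a := 0) (b := 1)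
                (C := [[0,2,4],[0,2,1,3],[0,3,1,2,4]]) (T := [0,3,1,2,4]) (by decide) rfl
            · rw [show num d 3 = 4 by omega, List.map_cons, List.map_nil, show d h = 6 by omega] at q5
              exact explicitF q3 q4 q5 (E := [(0,2),(0,3),(0,4),(0,5),(0,6),(1,2),(1,3),(2,4),(3,5),(4,6)]) (a := 0) (b := 1)
                (C := [[0,2,4],[0,2,1,3],[0,3,1,2,4],[0,4,2,1,3,5]]) (T := [0,4,2,1,3,5]) (by decide) rfl
        · -- remove z
          push Not at hdom
          have s1 := sum_zer d z
          have c4 := cnt_zer d z (j := 4) (by omega)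
          have c3 := cnt_zer d z (j := 3) (by omega)
          have c1 := cnt_zer d z (j := 1) (by omega)
          rw [hz] at c4 c3 c1
          simp at c4 c3 c1
          have hge : ∀ v, 1 ≤ zer d z v → v ≠ z ∧ zer d z v = d v := by
            intro v hv
            by_cases e : v = z
            · subst e; rw [zer_self] at hv; omega
            · exact ⟨e, zer_ne e⟩
          by_cases hx' : Exc l (zer d z)
          · obtain ⟨rfl, x2, x3⟩ := hx'
            have hall : ∀ v, v ≠ z → 1 ≤ d v → d v = 3 := by
              intro v hv h1
              have := x3 v (by rw [zer_ne hv]; exact h1)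
              rwa [zer_ne hv] at this
            have hQ : Qs = [] := by
              rw [List.eq_nil_iff_forall_not_mem]
              intro v hv
              have h4 := (q2 v).1 hv
              have : v ≠ z := by rintro rfl; omega
              have := hall v this (by omega)
              omega
            have hn21 : num d 2 = 1 := by
              unfold num; rw [card_eq_one]
              refine ⟨z, ?_⟩
              ext v; simp
              constructor
              · intro h2; by_contra hc
                have := hall v hc (by omega)
                omega
              · rintro rfl; exact hz
            subst hQ
            simp at q7
            rw [hn1, hn21, show num d 3 = 8 by omega, List.map_nil] at q5
            exact explicitF q3 q4 q5 (E := [(0,3),(0,4),(0,6),(1,4),(1,6),(1,7),(2,6),(2,8),(3,4),(3,7),(5,7),(5,8)]) (a := 2) (b := 5)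
                (C := [[0,3,4],[0,4,1,6],[0,3,4,1,6],[0,4,3,7,1,6]]) (T := [0,4,3,7,1,6]) (by decide) rfl
          · apply Sub hz
            refine IH (zer d z) l (by omega) ?_ hl ?_ (by omega) (by intro; omega) ?_ ⟨ev - 1, by omega⟩ (by omega) (by omega) hx'
            · intro l' d' h'; exact ih l' d' (by omega)
            · intro v hv
              obtain ⟨_, e⟩ := hge v hv
              rw [e] at hv ⊢
              exact hd2 v hv
            · intro v hv
              obtain ⟨_, e⟩ := hge v hv
              rw [e] at hv ⊢
              have := hlt v hv
              have := hdom v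
              omega
      · have hn21 : num d 2 = 1 := by omega
        rcases hl with rfl | rfl
        · rcases hcases' with rfl | ⟨x, rfl⟩
          · simp at q7
            rw [hn1, hn21, show num d 3 = 4 by omega, List.map_nil] at q5
            exact explicitF q3 q4 q5 (E := [(0,1),(0,3),(1,2),(1,3),(2,4),(3,4)]) (a := 0) (b := 2)
                (C := [[0,1,3],[1,2,4,3],[0,1,2,4,3]]) (T := [0,1,2,4,3]) (by decide) rfl
          · have := hQlt x (by simp)
            simp at q6 q7
            omega
        · rcases hcases' with rfl | ⟨x, rfl⟩
          · simp at q6 q7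
            omega
          · have := hQlt x (by simp)
            simp at q6 q7
            rw [hn1, hn21, show num d 3 = 4 by omega, List.map_cons, List.map_nil, show d x = 4 by omega] at q5
            exact explicitF q3 q4 q5 (E := [(0,2),(0,3),(0,4),(1,2),(1,3),(2,4),(3,5),(4,5)]) (a := 0) (b := 1)
                (C := [[0,2,4],[0,2,1,3],[0,3,1,2,4],[0,2,1,3,5,4]]) (T := [0,2,1,3,5,4]) (by decide) rfl
    · push Not at hz
      have hn2 : num d 2 = 0 := by
        unfold num; rw [card_eq_zero, filter_eq_empty_iff]
        intro v _ hv; exact hz v hv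
      have hd3 : ∀ v, 1 ≤ d v → 3 ≤ d v := by
        intro v hv; have := hd2 v hv; have := hz v; omega
      by_cases hC2 : l < cnt d 1 ∧ l + 3 ≤ cnt d 1 + cnt d 4
      · obtain ⟨w, hw⟩ := card_pos.1 (show 0 < num d 3 by omega)
        have hw3 : d w = 3 := by simpa using hw
        have hgr : gr d := gr3 (by omega) (by omega) (by intro v hv; have := hd3 v hv; omega) hlt ⟨ev, hev'⟩
        refine (caseC2a (m := 2) ih (by omega) (by omega) (pos56 (by omega) (by omega) (by omega)) hgr (w := w) (by omega)
          (by intro v hv; rw [hw3]; exact hd3 v hv) ?_ (Or.inl ⟨hC2.1, ?_⟩)).1 hC2.1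
        · show cnt d 4 < d w
          omega
        · show l + 1 - 2 + (if 2 + 1 ≤ d w then 1 else 0) + (d w - cnt d 4) ≤ cnt d 3
          rw [hw3]; simp; omega
      · rcases hl with rfl | rfl
        · rcases hcases with rfl | ⟨x, rfl⟩ | ⟨x, y, rfl⟩
          · simp at q6 q7
            rw [hn1, hn2, show num d 3 = 6 by omega, List.map_nil] at q5
            exact explicitF q3 q4 q5 (E := [(0,2),(0,3),(1,2),(1,4),(2,5),(3,4),(3,5),(4,5)]) (a := 0) (b := 1)
                (C := [[3,4,5],[0,2,5,3],[0,2,5,4,3]]) (T := [0,2,5,4,3]) (by decide) rfl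
          · have := hQlt x (by simp)
            simp at q6 q7
            have h56 : cnt d 1 = 5 ∨ cnt d 1 = 6 := by omega
            rcases h56 with h | h
            · rw [hn1, hn2, show num d 3 = 4 by omega, List.map_cons, List.map_nil, show d x = 4 by omega] at q5
              exact explicitF q3 q4 q5 (E := [(0,2),(0,3),(0,4),(1,2),(1,3),(2,4),(3,4)]) (a := 0) (b := 1)
                (C := [[0,2,4],[0,2,1,3],[0,2,1,3,4]]) (T := [0,2,1,3,4]) (by decide) rfl
            · rw [hn1, hn2, show num d 3 = 5 by omega, List.map_cons, List.map_nil, show d x = 5 by omega] at q5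
              exact explicitF q3 q4 q5 (E := [(0,2),(0,3),(0,4),(0,5),(1,2),(1,3),(2,4),(3,5),(4,5)]) (a := 0) (b := 1)
                (C := [[0,2,4],[0,2,1,3],[0,3,1,2,4]]) (T := [0,3,1,2,4]) (by decide) rfl
          · have := hQlt x (by simp)
            have := hQlt y (by simp)
            simp at q6 q7
            have h5 : cnt d 1 = 5 := by omega
            have hx4 : d x = 4 := by omega
            have hy4 : d y = 4 := by omega
            have h33 : num d 3 = 3 := by omega
            omega
        · rcases hcases with rfl | ⟨x, rfl⟩ | ⟨x, y, rfl⟩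
          · simp at q6 q7
            by_cases h8 : cnt d 1 = 8
            · exfalso
              refine hx ⟨rfl, h8, ?_⟩
              intro v hv
              have := hd3 v hv
              have := (q2 v).2
              simp at this
              omega
            · rw [hn1, hn2, show num d 3 = 6 by omega, List.map_nil] at q5
              exact explicitF q3 q4 q5 (E := [(0,2),(0,3),(1,2),(1,4),(2,5),(3,4),(3,5),(4,5)]) (a := 0) (b := 1)
                (C := [[3,4,5],[0,2,5,3],[0,2,1,4,3],[0,2,1,4,5,3]]) (T := [0,2,1,4,5,3]) (by decide) rfl
          · have := hQlt x (by simp)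
            simp at q6 q7
            have h56 : (cnt d 1 = 6 ∧ d x = 5) ∨ (cnt d 1 = 7 ∧ d x = 4) ∨ (cnt d 1 = 7 ∧ d x = 6) := by omega
            rcases h56 with ⟨h, h'⟩ | ⟨h, h'⟩ | ⟨h, h'⟩
            · rw [hn1, hn2, show num d 3 = 5 by omega, List.map_cons, List.map_nil, h'] at q5
              exact explicitF q3 q4 q5 (E := [(0,2),(0,3),(0,4),(0,5),(1,2),(1,3),(2,4),(3,5),(4,5)]) (a := 0) (b := 1)
                (C := [[0,2,4],[0,2,1,3],[0,3,1,2,4],[0,2,1,3,5,4]]) (T := [0,2,1,3,5,4]) (by decide) rfl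
            · rw [hn1, hn2, show num d 3 = 6 by omega, List.map_cons, List.map_nil, h'] at q5
              exact explicitF q3 q4 q5 (E := [(0,2),(0,3),(0,4),(1,2),(1,3),(2,5),(3,6),(4,5),(4,6),(5,6)]) (a := 0) (b := 1)
                (C := [[4,5,6],[0,2,5,4],[0,2,5,6,3],[0,2,5,4,6,3]]) (T := [0,2,5,4,6,3]) (by decide) rfl
            · rw [hn1, hn2, show num d 3 = 6 by omega, List.map_cons, List.map_nil, h'] at q5
              exact explicitF q3 q4 q5 (E := [(0,2),(0,3),(0,4),(0,5),(0,6),(1,2),(1,3),(2,4),(3,5),(4,6),(5,6)]) (a := 0) (b := 1)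
                (C := [[0,2,4],[0,2,1,3],[0,3,1,2,4],[0,4,2,1,3,5]]) (T := [0,4,2,1,3,5]) (by decide) rfl
          · have := hQlt x (by simp)
            have := hQlt y (by simp)
            simp at q6 q7
            have h56 : (d x = 4 ∧ d y = 4) ∨ (d x = 5 ∧ d y = 5) := by omega
            rcases h56 with ⟨h, h'⟩ | ⟨h, h'⟩
            · rw [hn1, hn2, show num d 3 = 4 by omega, List.map_cons, List.map_cons, List.map_nil, h, h'] at q5
              exact explicitF q3 q4 q5 (E := [(0,1),(0,3),(0,4),(1,2),(1,3),(1,4),(2,5),(3,5),(4,5)]) (a := 0) (b := 2)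
                (C := [[0,1,3],[0,3,1,4],[0,1,2,5,3],[0,3,1,2,5,4]]) (T := [0,3,1,2,5,4]) (by decide) rfl
            · rw [hn1, hn2, show num d 3 = 4 by omega, List.map_cons, List.map_cons, List.map_nil, h, h'] at q5
              exact explicitF q3 q4 q5 (E := [(0,2),(0,3),(0,4),(0,5),(1,2),(1,3),(1,4),(1,5),(2,3),(4,5)]) (a := 0) (b := 1)
                (C := [[0,2,3],[0,2,1,3],[0,2,3,1,4],[0,2,3,1,4,5]]) (T := [0,2,3,1,4,5]) (by decide) rfl

end I
end PT

set_option linter.all false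
namespace PT
open Finset
open scoped Classical

section J
variable {V : Type} [Fintype V]

theorem base5 {d : V → ℕ} (hP : Pos 5 d) (hg : gr d) (hn : cnt d 1 = 5) (hq : 2 ≤ cnt d 4) : Concl 5 d := by
  obtain ⟨G, hG⟩ := hg
  have hdom : ∀ a, 4 ≤ d a → ∀ u, u ≠ a → 1 ≤ d u → G.Adj a u := by
    intro a ha u hu hu1
    have h1 : nb G a ⊆ (supp d).erase a := by
      intro u hu
      rw [mem_nb] at hu
      exact mem_erase.2 ⟨hu.ne.symm, mem_supp.2 (adj_supp hG hu.symm)⟩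
    have h2 := eq_of_subset_of_card_le h1 (by
      rw [hG, card_erase_of_mem (mem_supp.2 (by omega)), supp_card]; omega)
    rw [← mem_nb, h2, mem_erase, mem_supp]
    exact ⟨hu, hu1⟩
  obtain ⟨a, ha, b, hb, hab⟩ := one_lt_card.1 (show 1 < cnt d 4 by omega)
  have ha4 : 4 ≤ d a := by simpa using ha
  have hb4 : 4 ≤ d b := by simpa using hb
  have hc : 1 < (((supp d).erase a).erase b).card := by
    rw [card_erase_of_mem (mem_erase.2 ⟨hab.symm, mem_supp.2 (by omega)⟩), card_erase_of_mem (mem_supp.2 (by omega)), supp_card]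
    omega
  obtain ⟨c, hc, e, he, hce⟩ := one_lt_card.1 hc
  rw [mem_erase, mem_erase, mem_supp] at hc he
  obtain ⟨hcb, hca, hc1⟩ := hc
  obtain ⟨heb, hea, he1⟩ := he
  refine ⟨G, supp d, hG, hn, ?_⟩
  intro r hr hr2
  have : r = 3 ∨ r = 4 ∨ r = 5 := by omega
  rcases this with rfl | rfl | rfl
  · refine ⟨fun i => if i = 0 then a else if i = 1 then b else c, ⟨?_, ?_, ?_⟩, ?_⟩
    · intro i hi j hj
      interval_cases i <;> interval_cases j <;> simp <;> tauto
    · intro i hi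
      have : i < 2 := by omega
      interval_cases i
      · simp; exact hdom a ha4 b hab.symm (by omega)
      · simp; exact hdom b hb4 c hcb hc1
    · simp; exact (hdom a ha4 c hca hc1).symm
    · intro i hi
      interval_cases i <;> simp [mem_supp] <;> omega
  · refine ⟨fun i => if i = 0 then a else if i = 1 then c else if i = 2 then b else e, ⟨?_, ?_, ?_⟩, ?_⟩
    · intro i hi j hj
      interval_cases i <;> interval_cases j <;> simp <;> tauto
    · intro i hi
      have : i < 3 := by omega
      interval_cases i
      · simp; exact hdom a ha4 c hca hc1
      · simp; exact (hdom b hb4 c hcb hc1).symm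
      · simp; exact hdom b hb4 e heb he1
    · simp; exact (hdom a ha4 e hea he1).symm
    · intro i hi
      interval_cases i <;> simp [mem_supp] <;> omega
  · exact posa_supp (by omega) hG hn hP

theorem step {d : V → ℕ} {l : ℕ} (ih : IHyp V (∑ v, d v)) (hl : 5 ≤ l)
    (hP : Pos l d) (hg : gr d) (hx : ¬ Exc l d) : Concl l d := by
  have hnl := Pos_n hl hP
  obtain ⟨w, hw, hmin⟩ := exists_min_image (supp d) d (card_pos.1 (by rw [supp_card]; omega))
  rw [mem_supp] at hw
  replace hmin : ∀ v, 1 ≤ d v → d w ≤ d v := fun v hv => hmin v (mem_supp.2 hv)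
  have hlt : ∀ v, 1 ≤ d v → d v < cnt d 1 := by obtain ⟨G, hG⟩ := hg; exact fun v hv => deg_lt hG hv
  have hev : Even (∑ v, d v) := by obtain ⟨G, hG⟩ := hg; exact hG.even
  have hc2 : l ≤ cnt d 2 := by have := hP 1 (by omega) (by omega); simpa using this
  obtain ⟨m, hm⟩ : ∃ m, (l - 1) / 2 = m := ⟨_, rfl⟩
  by_cases hq : d w ≤ cnt d (m+2)
  · by_cases h55 : l = 5 ∧ cnt d 1 = 5
    · obtain ⟨rfl, h5⟩ := h55
      have hm2 : m = 2 := by omega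
      subst hm2
      have hw2 : 2 ≤ d w := by
        by_contra hc
        have : cnt d 2 < cnt d 1 := by
          apply card_lt_card
          rw [ssubset_iff_of_subset (by intro v hv; simp at *; omega)]
          exact ⟨w, by simp; omega, by simp; omega⟩
        omega
      exact base5 hP hg h5 (hw2.trans hq)
    · exact caseC1 ih hl hm hP hg hw hmin hq h55
  · push Not at hq
    by_cases hl7 : 7 ≤ l
    · by_cases hodd : cnt d 1 = l ∧ l = 2 * m + 1
      · exact caseOdd ih hl7 hodd.2 hP hg hw hmin hodd.1
      by_cases hC : (l < cnt d 1 ∧ l + 1 - m + (if m + 1 ≤ d w then 1 else 0) + (d w - cnt d (m+2)) ≤ cnt d (m+1)) ∨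
          (6 ≤ l ∧ cnt d 1 = l ∧ l = 2 * m + 2 ∧ l - m + (if m + 1 ≤ d w then 1 else 0) + (d w - cnt d (m+2)) ≤ cnt d (m+1))
      · exact (caseC2a ih hl hm hP hg hw hmin hq hC).2
      by_cases hdom : ∃ h, 1 ≤ d h ∧ d h + 1 = cnt d 1
      · obtain ⟨h, h1, h2⟩ := hdom
        exact caseDom ih hl7 hP hg h1 h2
      · push Not at hdom
        refine caseMain ih hl7 hm hP hg hw hmin hq (by omega) ?_ ?_
        · intro v
          by_cases h1 : 1 ≤ d v
          · have := hlt v h1; have := hdom v h1; omega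
          · omega
        · generalize (if m + 1 ≤ d w then 1 else 0) = I at *
          omega
    · have hm2 : m = 2 := by omega
      subst hm2
      have hq' : cnt d 4 < d w := hq
      have hc3 : l ≤ cnt d 3 + 1 := by
        have := hP 2 (by omega) (by omega)
        have : l + 1 - 2 ≤ cnt d 3 := this
        omega
      have ht3 : d w ≤ 3 := by
        by_contra hc
        have := cnt_min hmin (show 4 ≤ d w by omega)
        have := hlt w hw
        omega
      by_cases ht : 2 ≤ d w
      · refine (T2 _ d l le_rfl ih (by omega) (fun v hv => ht.trans (hmin v hv)) (by omega) ?_ hlt hev hnl hc3 hx).concl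
        rintro ⟨z, hz⟩
        have := hmin z (by omega)
        omega
      · have ht1 : d w = 1 := by omega
        have hn1 : l < cnt d 1 := by
          have : cnt d 2 < cnt d 1 := by
            apply card_lt_card
            rw [ssubset_iff_of_subset (by intro v hv; simp at *; omega)]
            exact ⟨w, by simp; omega, by simp; omega⟩
          omega
        by_cases hp : l ≤ cnt d 3
        · refine (caseC2a (m := 2) ih hl hm hP hg hw hmin hq (Or.inl ⟨hn1, ?_⟩)).2
          show l + 1 - 2 + (if 2 + 1 ≤ d w then 1 else 0) + (d w - cnt d 4) ≤ cnt d 3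
          rw [ht1]; simp; omega
        · exact caseT1 ih (by omega) hg ht1 (by omega) (by omega) hc2

theorem all (N : ℕ) : IHyp V N := by
  induction N with
  | zero => intro l d h; omega
  | succ N IH =>
    intro l d h hl hP hg hx
    refine step ?_ hl hP hg hx
    intro l' d' h'
    exact IH l' d' (by omega)

theorem weak {d : V → ℕ} {l : ℕ} (hl : 5 ≤ l) (hP : Pos l d) (hg : gr d) :
    ∃ (G : SimpleGraph V) (S : Finset V), RL G d ∧ ∀ r, 3 ≤ r → r ≤ l → Cyc G S r := by
  by_cases hx : Exc l d
  · obtain ⟨rfl, e8, e3⟩ := hx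
    obtain ⟨G8, S8, r1, _, a8, b8, _, r2⟩ := explicit (d := d) (L := (supp d).toList) (nodup_toList _)
        (by intro v hv; rw [mem_toList, mem_supp]; exact hv) (map_const (fun v hv => e3 v (mem_supp.1 hv)) e8) (l := 8)
        (E := [(0,5),(0,7),(1,4),(1,7),(2,3),(2,5),(2,6),(3,4),(3,5),(4,6),(6,7)]) (a := 0) (b := 1)
        (C := [[2,3,5],[1,4,6,7],[0,5,2,6,7],[0,5,3,4,1,7],[0,5,2,3,4,1,7],[0,5,3,2,6,4,1,7]])
        (T := [0,1,2,3,4,5,6,7]) (by decide)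
    exact ⟨G8, S8, r1, fun r hr hr2 => (r2 r hr (by omega)).mono (G := delE G8 a8 b8) (fun x _ y _ h => h.1) (Subset.refl _) (by omega)⟩
  · obtain ⟨G, S, h1, _, h3⟩ := all (∑ v, d v + 1) l d (by omega) hl hP hg hx
    exact ⟨G, S, h1, h3⟩

theorem Cyc.walk {G : SimpleGraph V} {S : Finset V} {r : ℕ} (hr : 3 ≤ r) (h : Cyc G S r) :
    ∃ (v : V) (c : G.Walk v v), c.IsCycle ∧ c.length = r := by
  obtain ⟨p, ⟨h1, h2, h3⟩, _⟩ := h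
  rw [← SimpleGraph.cycleGraph_isContained_iff (by omega)]
  have key : ∀ x y : Fin r, (x - y).val = 1 → G.Adj (p x) (p y) := by
    intro x y hxy
    rcases le_or_gt y x with hle | hlt
    · rw [Fin.sub_val_of_le hle] at hxy
      have : x.val = y.val + 1 := by omega
      rw [this]
      exact (h2 y.val (by omega)).symm
    · rw [Fin.coe_sub_iff_lt.2 hlt] at hxy
      have e1 : x.val = 0 := by omega
      have e2 : y.val = r - 1 := by omega
      rw [e1, e2]
      exact h3.symm
  refine ⟨⟨⟨fun i => p i.val, ?_⟩, ?_⟩⟩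
  · intro x y hxy
    rcases SimpleGraph.cycleGraph_adj'.1 hxy with h | h
    · exact key x y h
    · exact (key y x h).symm
  · intro x y hxy
    exact Fin.ext (h1 x.val x.isLt y.val y.isLt hxy)

theorem RL_iff {G : SimpleGraph V} {d : V → ℕ} : RL G d ↔ ∀ v, (G.neighborSet v).ncard = d v := by
  have : ∀ v, (G.neighborSet v).ncard = (nb G v).card := by
    intro v
    rw [← Set.ncard_coe_finset]
    congr 1
    ext u
    simp [mem_nb]
  simp only [this]; rfl

end J
end PT

/-- **Pósa-type condition (Theorem 1.3).** If `ℓ ≥ 5`, `n ≥ ℓ` and `π = (d₁,…,dₙ)` is a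
non-increasing graphic sequence with `d_{ℓ+1-i} ≥ i+1` for every `1 ≤ i < ℓ/2`, then `π`
is potentially ₃Cℓ-graphic. -/
theorem posa_type_pot3C (ℓ n : ℕ) (hl : 5 ≤ ℓ) (hn : ℓ ≤ n) (d : Fin n → ℕ)
    (hanti : Antitone d) (hgr : Graphic d)
    (hposa : ∀ i : ℕ, ∀ _ : 1 ≤ i, ∀ _ : 2 * i < ℓ, i + 1 ≤ d ⟨ℓ - i, by omega⟩) :
    Pot3C ℓ d := by
  obtain ⟨G0, hG0⟩ := hgr
  have hg : PT.gr d := ⟨G0, PT.RL_iff.2 hG0⟩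
  have hP : PT.Pos ℓ d := by
    intro i hi hi2
    have h1 := hposa i hi hi2
    have hsub : Finset.Iic (⟨ℓ - i, by omega⟩ : Fin n) ⊆ Finset.univ.filter (fun v => i + 1 ≤ d v) := by
      intro v hv
      rw [Finset.mem_Iic] at hv
      rw [Finset.mem_filter]
      exact ⟨Finset.mem_univ _, h1.trans (hanti hv)⟩
    have h2 := Finset.card_le_card hsub
    rw [Fin.card_Iic] at h2
    have h3 : (Finset.univ.filter (fun v => i + 1 ≤ d v)).card = PT.cnt d (i+1) := by
      unfold PT.cnt; congr
    simp only at h2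
    omega
  obtain ⟨G, S, h1, h2⟩ := PT.weak hl hP hg
  exact ⟨G, PT.RL_iff.1 h1, fun r hr hr2 => (h2 r hr hr2).walk hr⟩
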